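/- For every good sponge Λ_Φ ⊆ [0,1]^d, HD(Λ_Φ) ≤ max(1, d−1) · DynD(Φ). In particular, if d ≤ 2 then HD(Λ_Φ) = DynD(Φ). -/

import Mathlib

open MeasureTheory Filter Set Metric
open scoped Classical Topology ENNReal NNReal

namespace SelfAffineSponge

/-- A diagonal IFS on `[0,1]^d`: for each coordinate `i ∈ D = Fin d` a finite alphabet
`A i` indexing affine maps `x ↦ slope i a * x + off i a` of `[0,1]`, together with a
set `E ⊆ ∏ i, A i` of allowed tuples of symbols. -/
structure DiagIFS (d : ℕ) (A : Fin d → Type) [∀ i, Fintype (A i)] where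
  slope : ∀ i : Fin d, A i → ℝ
  off : ∀ i : Fin d, A i → ℝ
  E : Finset (∀ i, A i)

variable {d : ℕ} {A : Fin d → Type} [∀ i, Fintype (A i)]

namespace DiagIFS

/-- the base similarity `φ_{i,a}` in coordinate `i` -/
def base (Φ : DiagIFS d A) (i : Fin d) (a : A i) (x : ℝ) : ℝ :=
  Φ.slope i a * x + Φ.off i a

/-- the data defines an honest diagonal IFS: `E` is nonempty and each base map is a
contracting similarity of `[0,1]` -/
def Valid (Φ : DiagIFS d A) : Prop :=
  Φ.E.Nonempty ∧ (∀ i a, Φ.slope i a ≠ 0) ∧ (∀ i a, |Φ.slope i a| < 1) ∧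
    ∀ i a, ∀ x ∈ Set.Icc (0:ℝ) 1, Φ.base i a x ∈ Set.Icc (0:ℝ) 1

/-- the alphabet `E` of the IFS, as a type -/
abbrev Symb (Φ : DiagIFS d A) : Type _ := {a : ∀ i, A i // a ∈ Φ.E}

instance (Φ : DiagIFS d A) : MeasurableSpace Φ.Symb := ⊤
instance (Φ : DiagIFS d A) : TopologicalSpace Φ.Symb := ⊥

/-- the affine contraction `φ_a` of `[0,1]^d` associated to a tuple of symbols -/
def affMap (Φ : DiagIFS d A) (a : ∀ i, A i) (x : Fin d → ℝ) : Fin d → ℝ :=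
  fun i => Φ.base i (a i) (x i)

/-- the coding map `π(ω) = lim_n φ_{ω_0}∘⋯∘φ_{ω_{n-1}}(0)`, written in closed form -/
noncomputable def coding (Φ : DiagIFS d A) (ω : ℕ → Φ.Symb) : Fin d → ℝ :=
  fun i => ∑' n : ℕ, (∏ k ∈ Finset.range n, Φ.slope i ((ω k).1 i)) * Φ.off i ((ω n).1 i)

/-- the limit set `Λ_Φ = π(E^ℕ)` (the self-affine sponge) -/
def limitSet (Φ : DiagIFS d A) : Set (Fin d → ℝ) :=
  Set.range Φ.coding

theorem coding_mem (Φ : DiagIFS d A) (ω : ℕ → Φ.Symb) : Φ.coding ω ∈ Φ.limitSet :=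
  ⟨ω, rfl⟩

/-- the `i`-th Lyapunov exponent `χ_i(p) = -∫ log|φ'_{a,i}| dp(a)` of a finite measure
`p` on `E` (given by its density) -/
noncomputable def chi (Φ : DiagIFS d A) (i : Fin d) (p : Φ.Symb → ℝ) : ℝ :=
  -∑ a : Φ.Symb, p a * Real.log |Φ.slope i (a.1 i)|

/-- the mass `p([a]_I)` of the cylinder `[a]_I = {b ∈ E : b_i = a_i ∀ i ∈ I}` -/
noncomputable def cylMass (Φ : DiagIFS d A) (I : Finset (Fin d)) (p : Φ.Symb → ℝ)
    (a : Φ.Symb) : ℝ :=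
  ∑ b : Φ.Symb, if ∀ i ∈ I, b.1 i = a.1 i then p b else 0

/-- the entropy `h(I; p) = -∫ log p([a]_I) dp(a)` -/
noncomputable def entropy (Φ : DiagIFS d A) (I : Finset (Fin d)) (p : Φ.Symb → ℝ) : ℝ :=
  -∑ a : Φ.Symb, p a * Real.log (Φ.cylMass I p a)

/-- the conditional entropy `h(I' | I; p) = h(I';p) - h(I;p)` -/
noncomputable def condEntropy (Φ : DiagIFS d A) (I I' : Finset (Fin d))
    (p : Φ.Symb → ℝ) : ℝ :=
  Φ.entropy I' p - Φ.entropy I p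

/-- a coordinate set `I ⊆ D` is good if the projected IFS `Φ_I` satisfies the open set
condition: the boxes `φ_{I,a}((0,1)^I)`, indexed by distinct projections of elements of
`E`, are pairwise disjoint (equivalently, some coordinate has disjoint intervals). -/
def GoodIdx (Φ : DiagIFS d A) (I : Finset (Fin d)) : Prop :=
  ∀ a ∈ Φ.E, ∀ b ∈ Φ.E, (∃ i ∈ I, a i ≠ b i) →
    ∃ i ∈ I, Disjoint (Φ.base i (a i) '' Set.Ioo (0:ℝ) 1)
      (Φ.base i (b i) '' Set.Ioo (0:ℝ) 1)

/-- Barański condition: each base IFS satisfies the open set condition w.r.t. `(0,1)` -/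
def Baranski (Φ : DiagIFS d A) : Prop :=
  ∀ i : Fin d, ∀ a b : A i, a ≠ b →
    Disjoint (Φ.base i a '' Set.Ioo (0:ℝ) 1) (Φ.base i b '' Set.Ioo (0:ℝ) 1)

/-- strong Barański condition: each base IFS satisfies the strong separation condition
w.r.t. `[0,1]` -/
def StronglyBaranski (Φ : DiagIFS d A) : Prop :=
  ∀ i : Fin d, ∀ a b : A i, a ≠ b →
    Disjoint (Φ.base i a '' Set.Icc (0:ℝ) 1) (Φ.base i b '' Set.Icc (0:ℝ) 1)

/-- coordinate ordering condition: some permutation `σ` of the coordinates has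
`|φ'_{a,σ(1)}| > ⋯ > |φ'_{a,σ(d)}|` for all `a ∈ E` -/
def CoordOrdering (Φ : DiagIFS d A) : Prop :=
  ∃ σ : Equiv.Perm (Fin d), ∀ a ∈ Φ.E, ∀ i j : Fin d, i < j →
    |Φ.slope (σ j) (a (σ j))| < |Φ.slope (σ i) (a (σ i))|

end DiagIFS

/-- a probability vector (probability measure on a finite set, via its density) -/
def IsProbVec {α : Type*} [Fintype α] (p : α → ℝ) : Prop :=
  (∀ a, 0 ≤ p a) ∧ ∑ a, p a = 1

/-- a measure `p` on `E` is good if `I(p,x) = {i : χ_i(p) ≤ x}` is good for all `x > 0` -/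
def DiagIFS.GoodVec (Φ : DiagIFS d A) (p : Φ.Symb → ℝ) : Prop :=
  ∀ x > 0, Φ.GoodIdx (Finset.univ.filter fun i => Φ.chi i p ≤ x)

/-- a cycle on `E`: a continuous exponentially `λ`-periodic map `(0,∞) → P`,
where `λ = 1` means constant -/
structure Cycle (Φ : DiagIFS d A) where
  lam : ℝ
  one_le_lam : 1 ≤ lam
  r : ℝ → Φ.Symb → ℝ
  prob : ∀ b > 0, IsProbVec (r b)
  cont : ContinuousOn r (Set.Ioi 0)
  periodic : ∀ b > 0, r (lam * b) = r b
  const_of_lam_eq_one : lam = 1 → ∀ b > 0, ∀ b' > 0, r b = r b'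

/-- the number `B_i`, determined by `B = ∫_0^{B_i} χ_i(r_b) db` (written via `sInf`;
for a cycle the function `x ↦ ∫_0^x χ_i(r_b) db` is continuous and strictly
increasing, so the infimum is the unique solution) -/
noncomputable def Bcoord (Φ : DiagIFS d A) (r : ℝ → Φ.Symb → ℝ) (B : ℝ) (i : Fin d) : ℝ :=
  sInf {x : ℝ | 0 ≤ x ∧ B ≤ ∫ b in Set.Ioc (0:ℝ) x, Φ.chi i (r b)}

/-- `δ(r, B) = B⁻¹ ∫_0^∞ h({i : b ≤ B_i}; r_b) db` -/
noncomputable def deltaRB (Φ : DiagIFS d A) (r : ℝ → Φ.Symb → ℝ) (B : ℝ) : ℝ :=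
  B⁻¹ * ∫ b in Set.Ioi (0:ℝ),
    Φ.entropy (Finset.univ.filter fun i => b ≤ Bcoord Φ r B i) (r b)

/-- `δ(r) = inf_{B ∈ [1,λ]} δ(r,B)` -/
noncomputable def Cycle.delta {Φ : DiagIFS d A} (c : Cycle Φ) : ℝ :=
  sInf (deltaRB Φ c.r '' Set.Icc 1 c.lam)

/-- `δ(p) = ∫_0^∞ h({i : b ≤ 1/χ_i(p)}; p) db` -/
noncomputable def deltaP (Φ : DiagIFS d A) (p : Φ.Symb → ℝ) : ℝ :=
  ∫ b in Set.Ioi (0:ℝ),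
    Φ.entropy (Finset.univ.filter fun i => b ≤ (Φ.chi i p)⁻¹) p

/-- the normalized average `R̂_B = B⁻¹ ∫_0^B r_b db` of a cycle -/
noncomputable def cycleAvg {Φ : DiagIFS d A} (c : Cycle Φ) (B : ℝ) : Φ.Symb → ℝ :=
  fun a => B⁻¹ * ∫ b in Set.Ioc (0:ℝ) B, c.r b a

/-- a cycle is good if all its normalized averages `R̂_B` are good -/
def Cycle.Good {Φ : DiagIFS d A} (c : Cycle Φ) : Prop :=
  ∀ B > 0, Φ.GoodVec (cycleAvg c B)

/-- a cycle is nondegenerate if `{b > 0 : r_b(a) > 0 ∀ a ∈ E_r}` is dense in `(0,∞)` -/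
def Cycle.Nondeg {Φ : DiagIFS d A} (c : Cycle Φ) : Prop :=
  Set.Ioi (0:ℝ) ⊆
    closure {b : ℝ | 0 < b ∧ ∀ a : Φ.Symb, (∃ b' > 0, 0 < c.r b' a) → 0 < c.r b a}

/-- the lower pointwise dimension `d̲(x,μ) = liminf_{ρ→0} log μ(B(x,ρ))/log ρ` -/
noncomputable def lowerPtDim {X : Type*} [PseudoMetricSpace X] [MeasurableSpace X]
    (μ : Measure X) (x : X) : ℝ≥0∞ :=
  Filter.liminf
    (fun ρ : ℝ => ENNReal.ofReal (Real.log (μ (Metric.ball x ρ)).toReal / Real.log ρ))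
    (𝓝[>] (0:ℝ))

/-- the Hausdorff dimension of a measure: the essential supremum of its lower
pointwise dimension -/
noncomputable def measDim {X : Type*} [PseudoMetricSpace X] [MeasurableSpace X]
    (μ : Measure X) : ℝ≥0∞ :=
  essSup (lowerPtDim μ) μ

/-- the shift map on `E^ℕ` -/
def shift {α : Type*} (ω : ℕ → α) : ℕ → α := fun n => ω (n + 1)

/-- the dynamical dimension: the supremum of `HD(π_*μ)` over shift-invariant
probability measures `μ` on `E^ℕ` -/
noncomputable def DiagIFS.dynDim (Φ : DiagIFS d A) : ℝ≥0∞ :=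
  sSup {x : ℝ≥0∞ | ∃ μ : Measure (ℕ → Φ.Symb), IsProbabilityMeasure μ ∧
    Measure.map shift μ = μ ∧ x = measDim (Measure.map Φ.coding μ)}

/-- `μ` is the product measure on `E^ℕ` whose `k`-th factor has density `p k`
(this property characterizes `μ` uniquely) -/
def IsProductMeasure (Φ : DiagIFS d A) (p : ℕ → Φ.Symb → ℝ)
    (μ : Measure (ℕ → Φ.Symb)) : Prop :=
  IsProbabilityMeasure μ ∧
    ∀ (n : ℕ) (w : ℕ → Φ.Symb),
      (μ {ω | ∀ k < n, ω k = w k}).toReal = ∏ k ∈ Finset.range n, p k (w k)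

/-- the set of Hausdorff dimensions of Bernoulli measures `ν_p = π_*[p^ℕ]` -/
noncomputable def bernoulliDims (Φ : DiagIFS d A) : Set ℝ≥0∞ :=
  {x | ∃ p : Φ.Symb → ℝ, IsProbVec p ∧ ∃ μ : Measure (ℕ → Φ.Symb),
    IsProductMeasure Φ (fun _ => p) μ ∧ x = measDim (Measure.map Φ.coding μ)}

/-- the set of Hausdorff dimensions of pseudo-Bernoulli measures
`ν_r = π_*[∏_n r_n]` -/
noncomputable def pseudoBernoulliDims (Φ : DiagIFS d A) : Set ℝ≥0∞ :=
  {x | ∃ c : Cycle Φ, ∃ μ : Measure (ℕ → Φ.Symb),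
    IsProductMeasure Φ (fun n => c.r ((n : ℝ) + 1)) μ ∧
      x = measDim (Measure.map Φ.coding μ)}

namespace DiagIFS

/-- minus the logarithm of the contraction ratio of the symbol `a` in coordinate `i` -/
noncomputable def rate (Φ : DiagIFS d A) (i : Fin d) (a : Φ.Symb) : ℝ :=
  -Real.log |Φ.slope i (a.1 i)|

/-- the total contraction rate in coordinate `i` of the first `n` symbols of `ω` -/
noncomputable def birkhoff (Φ : DiagIFS d A) (ω : ℕ → Φ.Symb) (i : Fin d) (n : ℕ) : ℝ :=
  ∑ k ∈ Finset.range n, Φ.rate i (ω k)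

/-- the slope in coordinate `i` of `φ_{ω_0} ∘ ⋯ ∘ φ_{ω_{n-1}}` -/
def slopeProd (Φ : DiagIFS d A) (ω : ℕ → Φ.Symb) (i : Fin d) (n : ℕ) : ℝ :=
  ∏ k ∈ Finset.range n, Φ.slope i ((ω k).1 i)

/-- the map `φ_{ω_0} ∘ ⋯ ∘ φ_{ω_{n-1}}` in coordinate `i` -/
def cylMap (Φ : DiagIFS d A) (ω : ℕ → Φ.Symb) (i : Fin d) (n : ℕ) (x : ℝ) : ℝ :=
  ∑ k ∈ Finset.range n, Φ.slopeProd ω i k * Φ.off i ((ω k).1 i) + Φ.slopeProd ω i n * x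

theorem exists_rate_bounds (Φ : DiagIFS d A) (hV : Φ.Valid) :
    ∃ c > 0, ∃ C > 0, ∀ i (a : Φ.Symb), c ≤ Φ.rate i a ∧ Φ.rate i a ≤ C := by
  rcases isEmpty_or_nonempty (Fin d × Φ.Symb) with h | h
  · exact ⟨1, one_pos, 1, one_pos, fun i a => (h.false (i, a)).elim⟩
  · obtain ⟨x, hx⟩ := Finite.exists_max fun z : Fin d × Φ.Symb => Φ.rate z.1 z.2
    obtain ⟨y, hy⟩ := Finite.exists_min fun z : Fin d × Φ.Symb => Φ.rate z.1 z.2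
    have pos : ∀ i (a : Φ.Symb), 0 < Φ.rate i a := fun i a =>
      neg_pos.2 (Real.log_neg (abs_pos.2 (hV.2.1 _ _)) (hV.2.2.1 _ _))
    exact ⟨_, pos y.1 y.2, _, pos x.1 x.2, fun i a => ⟨hy (i, a), hx (i, a)⟩⟩

theorem abs_slopeProd (Φ : DiagIFS d A) (hV : Φ.Valid) (ω : ℕ → Φ.Symb) (i : Fin d) (n : ℕ) :
    |Φ.slopeProd ω i n| = Real.exp (-Φ.birkhoff ω i n) := by
  rw [slopeProd, Finset.abs_prod, birkhoff, ← Finset.sum_neg_distrib, Real.exp_sum]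
  refine Finset.prod_congr rfl fun k _ => ?_
  rw [rate, neg_neg, Real.exp_log (abs_pos.2 (hV.2.1 _ _))]

theorem cylMap_succ (Φ : DiagIFS d A) (ω : ℕ → Φ.Symb) (i : Fin d) (n : ℕ) (x : ℝ) :
    Φ.cylMap ω i (n + 1) x = Φ.cylMap ω i n (Φ.base i ((ω n).1 i) x) := by
  simp only [cylMap, slopeProd, base, Finset.sum_range_succ, Finset.prod_range_succ]
  ring

theorem cylMap_congr (Φ : DiagIFS d A) {ω ω' : ℕ → Φ.Symb} {i : Fin d} {n : ℕ}
    (h : ∀ k < n, (ω k).1 i = (ω' k).1 i) : Φ.cylMap ω i n = Φ.cylMap ω' i n := by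
  have key : ∀ m ≤ n, Φ.slopeProd ω i m = Φ.slopeProd ω' i m := fun m hm =>
    Finset.prod_congr rfl fun k hk => by rw [h k ((Finset.mem_range.1 hk).trans_le hm)]
  funext x
  rw [cylMap, cylMap, key n le_rfl]
  congr 1
  refine Finset.sum_congr rfl fun k hk => ?_
  rw [key k (Finset.mem_range.1 hk).le, h k (Finset.mem_range.1 hk)]

theorem cylMap_mem_Icc (Φ : DiagIFS d A) (hV : Φ.Valid) (ω : ℕ → Φ.Symb) (i : Fin d) (n : ℕ)
    {x : ℝ} (hx : x ∈ Icc (0 : ℝ) 1) : Φ.cylMap ω i n x ∈ Icc (0 : ℝ) 1 := by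
  induction n generalizing x with
  | zero => simpa [cylMap, slopeProd] using hx
  | succ n ih => rw [cylMap_succ]; exact ih (hV.2.2.2 i _ x hx)

theorem base_mem_Ioo (Φ : DiagIFS d A) (hV : Φ.Valid) (i : Fin d) (a : A i)
    {x : ℝ} (hx : x ∈ Ioo (0 : ℝ) 1) : Φ.base i a x ∈ Ioo (0 : ℝ) 1 := by
  have h0 := hV.2.2.2 i a 0 (by simp)
  have h1 := hV.2.2.2 i a 1 (by simp)
  have hs := hV.2.1 i a
  simp only [base, mem_Icc, mul_zero, zero_add, mul_one] at h0 h1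
  simp only [base, mem_Ioo]
  rcases lt_or_gt_of_ne hs with h | h
  · constructor <;> nlinarith [mul_pos_of_neg_of_neg h (sub_neg.2 hx.2), mul_neg_of_neg_of_pos h hx.1]
  · constructor <;> nlinarith [mul_pos h (sub_pos.2 hx.2), mul_pos h hx.1]

theorem slopeProd_ne_zero (Φ : DiagIFS d A) (hV : Φ.Valid) (ω : ℕ → Φ.Symb) (i : Fin d) (n : ℕ) :
    Φ.slopeProd ω i n ≠ 0 :=
  Finset.prod_ne_zero_iff.2 fun _ _ => hV.2.1 _ _

theorem cylMap_injective (Φ : DiagIFS d A) (hV : Φ.Valid) (ω : ℕ → Φ.Symb) (i : Fin d) (n : ℕ) :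
    Function.Injective (Φ.cylMap ω i n) := fun x y h => by
  simpa [cylMap, Φ.slopeProd_ne_zero hV] using h

theorem cylMap_image_antitone (Φ : DiagIFS d A) (hV : Φ.Valid) (ω : ℕ → Φ.Symb) (i : Fin d) :
    Antitone fun n => Φ.cylMap ω i n '' Ioo (0 : ℝ) 1 := by
  refine antitone_nat_of_succ_le fun n => ?_
  rintro _ ⟨x, hx, rfl⟩
  exact ⟨_, Φ.base_mem_Ioo hV i _ hx, (Φ.cylMap_succ ω i n x).symm⟩

/-- If the symbols of `ω` and `ω'` in coordinate `i` first differ at time `k`, and the base maps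
at time `k` have disjoint images, then the cylinder intervals of any level `n > k` are disjoint. -/
theorem disjoint_cylMap_image (Φ : DiagIFS d A) (hV : Φ.Valid) {ω ω' : ℕ → Φ.Symb} {i : Fin d}
    {k n : ℕ} (hkn : k < n) (hk : ∀ j < k, (ω j).1 i = (ω' j).1 i)
    (hd : Disjoint (Φ.base i ((ω k).1 i) '' Ioo (0 : ℝ) 1)
      (Φ.base i ((ω' k).1 i) '' Ioo (0 : ℝ) 1)) :
    Disjoint (Φ.cylMap ω i n '' Ioo (0 : ℝ) 1) (Φ.cylMap ω' i n '' Ioo (0 : ℝ) 1) := by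
  refine Disjoint.mono (Φ.cylMap_image_antitone hV ω i hkn)
    (Φ.cylMap_image_antitone hV ω' i hkn) ?_
  have e : ∀ ω : ℕ → Φ.Symb, Φ.cylMap ω i (k + 1) '' Ioo (0 : ℝ) 1 =
      Φ.cylMap ω i k '' (Φ.base i ((ω k).1 i) '' Ioo (0 : ℝ) 1) := fun ω => by
    rw [image_image]; simp only [cylMap_succ]
  simp only [Nat.succ_eq_add_one, e, ← Φ.cylMap_congr hk]
  exact (disjoint_image_iff (Φ.cylMap_injective hV ω i k)).2 hd

theorem off_mem_Icc (Φ : DiagIFS d A) (hV : Φ.Valid) (i : Fin d) (a : A i) :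
    Φ.off i a ∈ Icc (0 : ℝ) 1 := by
  simpa [base] using hV.2.2.2 i a 0 (by simp)

theorem summable_abs_slopeProd (Φ : DiagIFS d A) (hV : Φ.Valid) (ω : ℕ → Φ.Symb) (i : Fin d) :
    Summable fun n => |Φ.slopeProd ω i n| := by
  obtain ⟨c, hc, C, -, h⟩ := Φ.exists_rate_bounds hV
  refine Summable.of_nonneg_of_le (fun _ => abs_nonneg _) (fun n => ?_)
    (summable_geometric_of_lt_one (Real.exp_pos (-c)).le (by simpa using hc))
  rw [Φ.abs_slopeProd hV, ← Real.exp_nat_mul, Real.exp_le_exp]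
  have : ∑ k ∈ Finset.range n, c ≤ Φ.birkhoff ω i n := Finset.sum_le_sum fun k _ => (h i _).1
  simp at this
  linarith

theorem summable_coding (Φ : DiagIFS d A) (hV : Φ.Valid) (ω : ℕ → Φ.Symb) (i : Fin d) :
    Summable fun n => Φ.slopeProd ω i n * Φ.off i ((ω n).1 i) := by
  refine Summable.of_norm_bounded (Φ.summable_abs_slopeProd hV ω i) fun n => ?_
  have := Φ.off_mem_Icc hV i ((ω n).1 i)
  rw [Real.norm_eq_abs, abs_mul, abs_of_nonneg this.1]
  exact mul_le_of_le_one_right (abs_nonneg _) this.2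

theorem coding_mem_Icc (Φ : DiagIFS d A) (hV : Φ.Valid) (ω : ℕ → Φ.Symb) (i : Fin d) :
    Φ.coding ω i ∈ Icc (0 : ℝ) 1 := by
  refine isClosed_Icc.mem_of_tendsto (Φ.summable_coding hV ω i).hasSum.tendsto_sum_nat
    (Eventually.of_forall fun n => ?_)
  have := Φ.cylMap_mem_Icc hV ω i n (x := 0) (by simp)
  simpa [cylMap] using this

theorem coding_eq_cylMap (Φ : DiagIFS d A) (hV : Φ.Valid) (ω : ℕ → Φ.Symb) (i : Fin d) (n : ℕ) :
    Φ.coding ω i = Φ.cylMap ω i n (Φ.coding (fun k => ω (k + n)) i) := by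
  have h := (Φ.summable_coding hV ω i).sum_add_tsum_nat_add n
  rw [show Φ.coding ω i = ∑' k, Φ.slopeProd ω i k * Φ.off i ((ω k).1 i) from rfl, ← h, cylMap]
  congr 1
  rw [coding, ← tsum_mul_left]
  refine tsum_congr fun k => ?_
  rw [← mul_assoc]
  congr 1
  rw [slopeProd, add_comm k n, Finset.prod_range_add, slopeProd]
  simp only [add_comm]

theorem abs_coding_sub_le (Φ : DiagIFS d A) (hV : Φ.Valid) {ω ω' : ℕ → Φ.Symb} {i : Fin d} {n : ℕ}
    (h : ∀ k < n, (ω k).1 i = (ω' k).1 i) :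
    |Φ.coding ω i - Φ.coding ω' i| ≤ Real.exp (-Φ.birkhoff ω i n) := by
  rw [Φ.coding_eq_cylMap hV ω i n, Φ.coding_eq_cylMap hV ω' i n, ← Φ.cylMap_congr h,
    ← Φ.abs_slopeProd hV]
  simp only [cylMap, add_sub_add_left_eq_sub, ← mul_sub, abs_mul]
  refine mul_le_of_le_one_right (abs_nonneg _) ?_
  have h1 := Φ.coding_mem_Icc hV (fun k => ω (k + n)) i
  have h2 := Φ.coding_mem_Icc hV (fun k => ω' (k + n)) i
  rw [abs_le]
  constructor <;> linarith [h1.1, h1.2, h2.1, h2.2]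

instance (Φ : DiagIFS d A) : DiscreteMeasurableSpace Φ.Symb := ⟨fun _ => trivial⟩

theorem measurable_coding (Φ : DiagIFS d A) (hV : Φ.Valid) : Measurable Φ.coding := by
  refine measurable_pi_lambda _ fun i => ?_
  refine measurable_of_tendsto_metrizable
    (f := fun n ω => ∑ k ∈ Finset.range n, Φ.slopeProd ω i k * Φ.off i ((ω k).1 i)) (fun n => ?_)
    (tendsto_pi_nhds.2 fun ω => (Φ.summable_coding hV ω i).hasSum.tendsto_sum_nat)
  have key : ∀ (g : Φ.Symb → ℝ) (k : ℕ), Measurable fun ω : ℕ → Φ.Symb => g (ω k) := fun g k =>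
    (measurable_of_countable g).comp (measurable_pi_apply k)
  refine Finset.measurable_sum _ fun k _ => Measurable.mul ?_ ?_
  · exact Finset.measurable_prod _ fun j _ => key (fun a => Φ.slope i (a.1 i)) j
  · exact key (fun a => Φ.off i (a.1 i)) k

end DiagIFS

theorem measDim_le_dimH {X : Type*} [MetricSpace X] [MeasurableSpace X] [BorelSpace X]
    (ν : Measure X) {s : Set X} [IsFiniteMeasure ν]
    (hs : ∀ u, MeasurableSet u → s ⊆ u → ν uᶜ = 0) : measDim ν ≤ dimH s := by
  by_contra! hlt
  obtain ⟨t, hst, ht⟩ := ENNReal.lt_iff_exists_nnreal_btwn.1 hlt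
  let S : ℕ → Set X := fun N =>
    {x | ∀ ρ ∈ Ioo (0 : ℝ) (1 / (N + 1)), ν (ball x ρ) ≤ ENNReal.ofReal ρ ^ (t : ℝ)}
  have hsub : {x | (t : ℝ≥0∞) < lowerPtDim ν x} ⊆ ⋃ N, S N := by
    intro x hx
    have hev : ∀ᶠ ρ in 𝓝[>] (0 : ℝ), (t : ℝ≥0∞) <
        ENNReal.ofReal (Real.log (ν (ball x ρ)).toReal / Real.log ρ) :=
      eventually_lt_of_lt_liminf hx
    obtain ⟨ε, hε, h⟩ := mem_nhdsGT_iff_exists_Ioo_subset.1 hev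
    obtain ⟨N, hN⟩ := exists_nat_one_div_lt (lt_min (mem_Ioi.1 hε) one_pos)
    refine mem_iUnion.2 ⟨N, fun ρ hρ => ?_⟩
    have hρ1 : ρ < 1 := hρ.2.trans (hN.trans_le (min_le_right _ _))
    have h1 : (t : ℝ≥0∞) < ENNReal.ofReal (Real.log (ν (ball x ρ)).toReal / Real.log ρ) :=
      h ⟨hρ.1, hρ.2.trans (hN.trans_le (min_le_left _ _))⟩
    have h2 : (t : ℝ) < Real.log (ν (ball x ρ)).toReal / Real.log ρ := by
      simpa using (ENNReal.lt_ofReal_iff_toReal_lt ENNReal.coe_ne_top).1 h1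
    have hlog : Real.log ρ < 0 := Real.log_neg hρ.1 hρ1
    rw [lt_div_iff_of_neg hlog] at h2
    have hpos : 0 < (ν (ball x ρ)).toReal := by
      refine ENNReal.toReal_nonneg.lt_of_ne fun h0 => ?_
      rw [← h0, Real.log_zero] at h2
      nlinarith [t.2, mul_nonneg_of_nonpos_of_nonpos (neg_nonpos.2 t.2) hlog.le]
    have h3 : (ν (ball x ρ)).toReal ≤ ρ ^ (t : ℝ) := by
      rw [← Real.log_le_log_iff hpos (Real.rpow_pos_of_pos hρ.1 _), Real.log_rpow hρ.1]
      exact h2.le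
    rw [ENNReal.ofReal_rpow_of_pos hρ.1]
    exact (ENNReal.le_ofReal_iff_toReal_le (measure_ne_top _ _) (Real.rpow_nonneg hρ.1.le _)).2 h3
  have hne : ν (⋃ N, S N) ≠ 0 := fun h0 => ht.not_ge <| essSup_le_of_ae_le _ <| by
    filter_upwards [measure_eq_zero_iff_ae_notMem.1 (measure_mono_null hsub h0)] with x hx
    simpa using hx
  obtain ⟨N, hN⟩ : ∃ N, ν (S N) ≠ 0 := by
    by_contra! h
    exact hne (measure_iUnion_null h)
  have hle : ν.restrict (S N) ≤ μH[t] := by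
    refine Measure.le_hausdorffMeasure _ _ (ENNReal.ofReal (1 / (2 * (N + 1))))
      (by positivity) fun u hu => ?_
    refine (measure_mono subset_closure).trans ?_
    rw [Measure.restrict_apply isClosed_closure.measurableSet]
    rcases (closure u ∩ S N).eq_empty_or_nonempty with h | ⟨x, hxu, hx⟩
    · simp [h]
    have hfin : ediam u ≠ ⊤ := (hu.trans_lt ENNReal.ofReal_lt_top).ne
    have hsmall : (ediam u).toReal < 1 / (N + 1) := by
      refine (ENNReal.toReal_le_of_le_ofReal (by positivity) hu).trans_lt ?_
      exact one_div_lt_one_div_of_lt (by positivity) (by linarith [N.cast_add_one_pos (α := ℝ)])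
    have htend : Tendsto (fun ρ => ENNReal.ofReal ρ ^ (t : ℝ)) (𝓝[>] (ediam u).toReal)
        (𝓝 (ediam u ^ (t : ℝ))) := by
      have := (ENNReal.continuous_rpow_const (y := (t : ℝ))).comp ENNReal.continuous_ofReal
      have := (this.tendsto (ediam u).toReal).mono_left
        (nhdsWithin_le_nhds (s := Ioi (ediam u).toReal))
      simpa [Function.comp_def, ENNReal.ofReal_toReal hfin] using this
    refine ge_of_tendsto htend ?_
    filter_upwards [Ioo_mem_nhdsGT hsmall] with ρ hρ
    refine (measure_mono fun y hy => ?_).trans (hx ρ ⟨ENNReal.toReal_nonneg.trans_lt hρ.1, hρ.2⟩)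
    have hed : edist y x ≤ ediam u := by
      rw [← ediam_closure]
      exact edist_le_ediam_of_mem hy.1 hxu
    rw [mem_ball, dist_edist]
    exact (ENNReal.toReal_mono hfin hed).trans_lt hρ.1
  have h0 : ν.restrict (S N) (toMeasurable μH[t] s) = 0 :=
    le_antisymm ((hle _).trans (by rw [measure_toMeasurable, hausdorffMeasure_of_dimH_lt hst]))
      bot_le
  have h1 : ν.restrict (S N) (toMeasurable μH[t] s)ᶜ = 0 :=
    Measure.restrict_le_self.absolutelyContinuous
      (hs _ (measurableSet_toMeasurable _ _) (subset_toMeasurable _ _))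
  apply hN
  rw [← Measure.restrict_apply_univ, ← union_compl_self (toMeasurable μH[t] s)]
  exact measure_union_null h0 h1

theorem DiagIFS.dynDim_le_dimH (Φ : DiagIFS d A) (hV : Φ.Valid) : Φ.dynDim ≤ dimH Φ.limitSet := by
  refine sSup_le ?_
  rintro _ ⟨μ, hμ, -, rfl⟩
  have := Measure.isProbabilityMeasure_map (μ := μ) (Φ.measurable_coding hV).aemeasurable
  refine measDim_le_dimH _ fun u hu hsub => ?_
  rw [Measure.map_apply (Φ.measurable_coding hV) hu.compl]
  convert measure_empty (μ := μ)
  exact eq_empty_of_forall_notMem fun ω hω => hω (hsub (Φ.coding_mem ω))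

namespace DiagIFS

theorem cylMass_nonneg (Φ : DiagIFS d A) {p : Φ.Symb → ℝ} (hp : ∀ a, 0 ≤ p a) (I : Finset (Fin d))
    (a : Φ.Symb) : 0 ≤ Φ.cylMass I p a :=
  Finset.sum_nonneg fun b _ => by split_ifs <;> simp [hp b]

theorem le_cylMass (Φ : DiagIFS d A) {p : Φ.Symb → ℝ} (hp : ∀ a, 0 ≤ p a) (I : Finset (Fin d))
    (a : Φ.Symb) : p a ≤ Φ.cylMass I p a := by
  refine le_trans (by simp) (Finset.single_le_sum (f := fun b : Φ.Symb =>
    if ∀ i ∈ I, b.1 i = a.1 i then p b else 0) (fun b _ => ?_) (Finset.mem_univ a))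
  split_ifs <;> simp [hp b]

theorem cylMass_anti (Φ : DiagIFS d A) {p : Φ.Symb → ℝ} (hp : ∀ a, 0 ≤ p a) {I J : Finset (Fin d)}
    (h : I ⊆ J) (a : Φ.Symb) : Φ.cylMass J p a ≤ Φ.cylMass I p a := by
  refine Finset.sum_le_sum fun b _ => ?_
  by_cases hb : ∀ i ∈ J, b.1 i = a.1 i
  · rw [if_pos hb, if_pos fun i hi => hb i (h hi)]
  · rw [if_neg hb]
    split_ifs <;> simp [hp b]

theorem cylMass_empty (Φ : DiagIFS d A) (p : Φ.Symb → ℝ) (a : Φ.Symb) :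
    Φ.cylMass ∅ p a = ∑ b, p b := by
  simp [cylMass]

theorem entropy_mono (Φ : DiagIFS d A) {p : Φ.Symb → ℝ} (hp : ∀ a, 0 ≤ p a) {I J : Finset (Fin d)}
    (h : I ⊆ J) : Φ.entropy I p ≤ Φ.entropy J p := by
  refine neg_le_neg (Finset.sum_le_sum fun a _ => ?_)
  rcases (hp a).eq_or_lt with h0 | h0
  · simp [← h0]
  · exact mul_le_mul_of_nonneg_left (Real.log_le_log (h0.trans_le (Φ.le_cylMass hp J a))
      (Φ.cylMass_anti hp h a)) h0.le

theorem entropy_empty (Φ : DiagIFS d A) {p : Φ.Symb → ℝ} (hp : IsProbVec p) :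
    Φ.entropy ∅ p = 0 := by
  simp only [entropy, cylMass_empty, hp.2, Real.log_one, mul_zero, Finset.sum_const_zero, neg_zero]

theorem entropy_nonneg (Φ : DiagIFS d A) {p : Φ.Symb → ℝ} (hp : IsProbVec p) (I : Finset (Fin d)) :
    0 ≤ Φ.entropy I p :=
  (Φ.entropy_empty hp).ge.trans (Φ.entropy_mono hp.1 (Finset.empty_subset I))

theorem cylMass_congr (Φ : DiagIFS d A) {p : Φ.Symb → ℝ} {I : Finset (Fin d)} {a b : Φ.Symb}
    (h : ∀ i ∈ I, a.1 i = b.1 i) : Φ.cylMass I p a = Φ.cylMass I p b := by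
  refine Finset.sum_congr rfl fun c _ => ?_
  have : (∀ i ∈ I, c.1 i = a.1 i) ↔ ∀ i ∈ I, c.1 i = b.1 i :=
    forall₂_congr fun i hi => by rw [h i hi]
  simp only [this]

/-- the number of occurrences of `a` among the first `n` letters of `ω` -/
noncomputable def count (Φ : DiagIFS d A) (ω : ℕ → Φ.Symb) (n : ℕ) (a : Φ.Symb) : ℕ :=
  ((Finset.range n).filter fun k => ω k = a).card

/-- the empirical measure of the first `n` letters of `ω` -/
noncomputable def freq (Φ : DiagIFS d A) (ω : ℕ → Φ.Symb) (n : ℕ) (a : Φ.Symb) : ℝ :=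
  Φ.count ω n a / n

theorem sum_range_eq_freq (Φ : DiagIFS d A) (ω : ℕ → Φ.Symb) (n : ℕ) (g : Φ.Symb → ℝ) :
    ∑ k ∈ Finset.range n, g (ω k) = n * ∑ a, Φ.freq ω n a * g a := by
  rcases n.eq_zero_or_pos with rfl | hn
  · simp
  have hn' : (n : ℝ) ≠ 0 := by positivity
  rw [← Finset.sum_fiberwise (Finset.range n) ω, Finset.mul_sum]
  refine Finset.sum_congr rfl fun a _ => ?_
  rw [Finset.sum_congr rfl fun k hk => by rw [(Finset.mem_filter.1 hk).2], Finset.sum_const,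
    freq, count, nsmul_eq_mul]
  field_simp

theorem freq_nonneg (Φ : DiagIFS d A) (ω : ℕ → Φ.Symb) (n : ℕ) (a : Φ.Symb) : 0 ≤ Φ.freq ω n a := by
  unfold freq; positivity

theorem freq_isProbVec (Φ : DiagIFS d A) (ω : ℕ → Φ.Symb) {n : ℕ} (hn : 0 < n) :
    IsProbVec (Φ.freq ω n) := by
  refine ⟨Φ.freq_nonneg ω n, ?_⟩
  have h := Φ.sum_range_eq_freq ω n fun _ => 1
  have hn' : (n : ℝ) ≠ 0 := by positivity
  simp only [Finset.sum_const, Finset.card_range, nsmul_eq_mul, mul_one] at h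
  exact (mul_left_cancel₀ hn' (by linarith)).symm

theorem freq_pos (Φ : DiagIFS d A) (ω : ℕ → Φ.Symb) {n k : ℕ} (hk : k < n) :
    0 < Φ.freq ω n (ω k) := by
  refine div_pos (Nat.cast_pos.2 (Finset.card_pos.2 ⟨k, ?_⟩)) (Nat.cast_pos.2 (by omega))
  simpa using hk

theorem birkhoff_eq (Φ : DiagIFS d A) (ω : ℕ → Φ.Symb) (i : Fin d) (n : ℕ) :
    Φ.birkhoff ω i n = n * Φ.chi i (Φ.freq ω n) := by
  rw [birkhoff, sum_range_eq_freq, chi, ← Finset.sum_neg_distrib]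
  simp [rate]

theorem prod_cylMass_freq (Φ : DiagIFS d A) (ω : ℕ → Φ.Symb) (n : ℕ) (I : Finset (Fin d)) :
    ∏ k ∈ Finset.range n, Φ.cylMass I (Φ.freq ω n) (ω k) =
      Real.exp (-(n * Φ.entropy I (Φ.freq ω n))) := by
  have h := Φ.sum_range_eq_freq ω n fun a => Real.log (Φ.cylMass I (Φ.freq ω n) a)
  rw [entropy, mul_neg, neg_neg, ← h, Real.exp_sum]
  refine Finset.prod_congr rfl fun k hk => (Real.exp_log ?_).symm
  exact (Φ.freq_pos ω (Finset.mem_range.1 hk)).trans_le (Φ.le_cylMass (Φ.freq_nonneg ω n) I _)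

/-- the symbols of `ω` in the coordinates `i ∈ I` at times `k < n i` -/
noncomputable def code (Φ : DiagIFS d A) (n : Fin d → ℕ) (N : ℕ) (I : Finset (Fin d))
    (ω : ℕ → Φ.Symb) : (i : Fin d) → Fin N → Option (A i) :=
  fun i k => if i ∈ I ∧ (k : ℕ) < n i then some ((ω k).1 i) else none

theorem code_eq_iff (Φ : DiagIFS d A) {n : Fin d → ℕ} {N : ℕ} (hN : ∀ i, n i ≤ N)
    {I : Finset (Fin d)} {ω ω' : ℕ → Φ.Symb} :
    Φ.code n N I ω = Φ.code n N I ω' ↔ ∀ i ∈ I, ∀ k < n i, (ω k).1 i = (ω' k).1 i := by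
  constructor
  · intro h i hi k hk
    have := congrFun (congrFun h i) ⟨k, hk.trans_le (hN i)⟩
    simpa [code, hi, hk] using this
  · intro h
    funext i k
    by_cases hik : i ∈ I ∧ (k : ℕ) < n i
    · simp [code, hik, h i hik.1 k hik.2]
    · simp [code, hik]

/-- Conditional type counting: sequences with prescribed empirical measure `q` up to time `n j`
and prescribed coordinates in `I` have at most `exp (n j * h({j} ∪ I | I; q))` different
symbol sequences in coordinate `j`. -/
theorem ncard_code_insert_le (Φ : DiagIFS d A) {n : Fin d → ℕ} {N : ℕ} (hN : ∀ i, n i ≤ N)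
    {I : Finset (Fin d)} {j : Fin d} (hI : ∀ i ∈ I, n j ≤ n i)
    {K : Set (ℕ → Φ.Symb)} {q : Φ.Symb → ℝ} (hK : ∀ ω ∈ K, Φ.freq ω (n j) = q) :
    ((Φ.code n N (insert j I) '' K).ncard : ℝ) ≤
      Real.exp (n j * (Φ.entropy (insert j I) q - Φ.entropy I q)) *
        (Φ.code n N I '' K).ncard := by
  set F := (Φ.code n N (insert j I) '' K).toFinset
  set G := (Φ.code n N I '' K).toFinset
  rw [Set.ncard_eq_toFinset_card', Set.ncard_eq_toFinset_card']
  let r : ((i : Fin d) → Fin N → Option (A i)) → ((i : Fin d) → Fin N → Option (A i)) :=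
    fun c i k => if i ∈ I then c i k else none
  have hr : ∀ ω, r (Φ.code n N (insert j I) ω) = Φ.code n N I ω := by
    intro ω
    funext i k
    by_cases hi : i ∈ I <;> simp [r, code, hi]
  have hmaps : ∀ c ∈ F, r c ∈ G := by
    intro c hc
    obtain ⟨ω, hω, rfl⟩ := Set.mem_toFinset.1 hc
    rw [hr]
    exact Set.mem_toFinset.2 ⟨ω, hω, rfl⟩
  rw [Finset.card_eq_sum_card_fiberwise (t := G) hmaps, Nat.cast_sum, mul_comm, ← nsmul_eq_mul]
  refine Finset.sum_le_card_nsmul _ _ _ fun b hb => ?_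
  obtain ⟨ω₀, hω₀, rfl⟩ := Set.mem_toFinset.1 hb
  set fib := F.filter fun c => r c = Φ.code n N I ω₀
  let y : ((i : Fin d) → Fin N → Option (A i)) → (Fin (n j) → Option (A j)) :=
    fun c k => c j ⟨k, k.2.trans_le (hN j)⟩
  have hfib : ∀ c ∈ fib, ∃ ω ∈ K, c = Φ.code n N (insert j I) ω ∧
      ∀ i ∈ I, ∀ k < n i, (ω k).1 i = (ω₀ k).1 i := by
    intro c hc
    obtain ⟨hc, hc'⟩ := Finset.mem_filter.1 hc
    obtain ⟨ω, hω, rfl⟩ := Set.mem_toFinset.1 hc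
    exact ⟨ω, hω, rfl, (Φ.code_eq_iff hN).1 ((hr ω).symm.trans hc')⟩
  have hy : ∀ ω (k : Fin (n j)), y (Φ.code n N (insert j I) ω) k = some ((ω k).1 j) := by
    intro ω k
    simp [y, code]
  have hinj : Set.InjOn y fib := by
    intro c hc c' hc' hcc
    obtain ⟨ω, -, rfl, hω⟩ := hfib c hc
    obtain ⟨ω', -, rfl, hω'⟩ := hfib c' hc'
    rw [Φ.code_eq_iff hN]
    intro i hi k hk
    rcases Finset.mem_insert.1 hi with rfl | hi
    · have := congrFun hcc ⟨k, hk⟩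
      rw [hy, hy] at this
      exact Option.some.inj this
    · rw [hω i hi k hk, hω' i hi k hk]
  let w : Fin (n j) → Option (A j) → ℝ := fun k o =>
    (∑ b : Φ.Symb, if (∀ i ∈ I, b.1 i = (ω₀ k).1 i) ∧ some (b.1 j) = o then q b else 0) /
      Φ.cylMass I q (ω₀ k)
  have hq : ∀ a, 0 ≤ q a := fun a => by rw [← hK ω₀ hω₀]; exact Φ.freq_nonneg _ _ _
  have hw0 : ∀ k o, 0 ≤ w k o := fun k o =>
    div_nonneg (Finset.sum_nonneg fun b _ => by split_ifs <;> simp [hq b]) (Φ.cylMass_nonneg hq I _)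
  have hw1 : ∀ k, ∑ o, w k o ≤ 1 := by
    intro k
    rw [← Finset.sum_div, Finset.sum_comm]
    refine div_le_one_of_le₀ (le_of_eq ?_) (Φ.cylMass_nonneg hq I _)
    refine Finset.sum_congr rfl fun b _ => ?_
    simp only [ite_and, Finset.sum_ite_irrel, Finset.sum_ite_eq, Finset.mem_univ, if_true,
      Finset.sum_const_zero]
  have hprod : ∀ c ∈ fib, ∏ k, w k (y c k) =
      Real.exp (-(n j * (Φ.entropy (insert j I) q - Φ.entropy I q))) := by
    intro c hc
    obtain ⟨ω, hωK, rfl, hω⟩ := hfib c hc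
    have hωk : ∀ k : Fin (n j), w k (y (Φ.code n N (insert j I) ω) k) =
        Φ.cylMass (insert j I) q (ω k) / Φ.cylMass I q (ω k) := by
      intro k
      have hag : ∀ i ∈ I, (ω k).1 i = (ω₀ k).1 i := fun i hi =>
        hω i hi k (k.2.trans_le (hI i hi))
      simp only [w, hy]
      rw [Φ.cylMass_congr hag]
      congr 1
      refine Finset.sum_congr rfl fun b _ => ?_
      have : ((∀ i ∈ I, b.1 i = (ω₀ k).1 i) ∧ some (b.1 j) = some ((ω k).1 j)) ↔
          ∀ i ∈ insert j I, b.1 i = (ω k).1 i := by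
        rw [Finset.forall_mem_insert, Option.some_inj, and_comm]
        exact and_congr_right fun _ => forall₂_congr fun i hi => by rw [hag i hi]
      simp only [this]
    simp only [hωk]
    rw [Finset.prod_div_distrib,
      Fin.prod_univ_eq_prod_range (fun k => Φ.cylMass (insert j I) q (ω k)),
      Fin.prod_univ_eq_prod_range (fun k => Φ.cylMass I q (ω k)), ← hK ω hωK,
      prod_cylMass_freq, prod_cylMass_freq, ← Real.exp_sub]
    congr 1
    ring
  have hsum : ∑ z ∈ fib.image y, ∏ k, w k (z k) ≤ 1 := by
    refine (Finset.sum_le_univ_sum_of_nonneg fun z => Finset.prod_nonneg fun k _ => hw0 k _).trans ?_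
    have := Finset.prod_univ_sum (fun _ : Fin (n j) => (Finset.univ : Finset (Option (A j)))) w
    rw [Fintype.piFinset_univ] at this
    rw [← this]
    exact Finset.prod_le_one (fun k _ => Finset.sum_nonneg fun o _ => hw0 k o) fun k _ => hw1 k
  rw [Finset.sum_image hinj, Finset.sum_congr rfl hprod, Finset.sum_const, nsmul_eq_mul,
    Real.exp_neg, ← div_eq_mul_inv, div_le_one (Real.exp_pos _)] at hsum
  exact hsum

/-- the set of the first `m` coordinates in the order given by `σ` -/
def pre (σ : Equiv.Perm (Fin d)) (m : ℕ) : Finset (Fin d) :=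
  Finset.univ.filter fun i => (σ.symm i : ℕ) < m

/-- the exponent bounding the number of codes with empirical measures `q` at times `n` -/
noncomputable def cost (Φ : DiagIFS d A) (n : Fin d → ℕ) (q : Fin d → Φ.Symb → ℝ)
    (σ : Equiv.Perm (Fin d)) (j : Fin d) : ℝ :=
  n (σ j) * (Φ.entropy (pre σ (j + 1)) (q (σ j)) - Φ.entropy (pre σ j) (q (σ j)))

theorem pre_succ (σ : Equiv.Perm (Fin d)) (j : Fin d) :
    pre σ (j + 1) = insert (σ j) (pre σ j) := by
  ext i
  simp only [pre, Finset.mem_filter, Finset.mem_univ, true_and, Finset.mem_insert,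
    Nat.lt_succ_iff_lt_or_eq, ← Equiv.symm_apply_eq, Fin.ext_iff]
  exact or_comm

theorem ncard_code_le (Φ : DiagIFS d A) {n : Fin d → ℕ} {N : ℕ} (hN : ∀ i, n i ≤ N)
    {σ : Equiv.Perm (Fin d)} (hσ : Antitone (n ∘ σ))
    {K : Set (ℕ → Φ.Symb)} {q : Fin d → Φ.Symb → ℝ} (hK : ∀ ω ∈ K, ∀ i, Φ.freq ω (n i) = q i) :
    ((Φ.code n N Finset.univ '' K).ncard : ℝ) ≤ Real.exp (∑ j, Φ.cost n q σ j) := by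
  have key : ∀ m ≤ d, ((Φ.code n N (pre σ m) '' K).ncard : ℝ) ≤
      Real.exp (∑ j ∈ Finset.univ.filter (fun j : Fin d => (j : ℕ) < m), Φ.cost n q σ j) := by
    intro m
    induction m with
    | zero =>
      intro _
      have : (Φ.code n N (pre σ 0) '' K).ncard ≤ 1 := by
        refine (Set.ncard_le_one_iff_subset_singleton (Set.toFinite _)).2 ⟨fun _ _ => none, ?_⟩
        rintro _ ⟨ω, -, rfl⟩
        refine Set.mem_singleton_iff.2 ?_
        funext i k
        simp [pre, code]
      simpa using this
    | succ m ih =>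
      intro hm
      have hps := pre_succ σ (⟨m, hm⟩ : Fin d)
      simp only at hps
      have hfil : (Finset.univ.filter fun j : Fin d => (j : ℕ) < m + 1) =
          insert ⟨m, hm⟩ (Finset.univ.filter fun j : Fin d => (j : ℕ) < m) := by
        ext j
        simp only [Finset.mem_filter, Finset.mem_univ, true_and, Finset.mem_insert, Fin.ext_iff]
        omega
      rw [hfil, Finset.sum_insert (by simp), Real.exp_add, hps]
      have hI : ∀ i ∈ pre σ m, n (σ ⟨m, hm⟩) ≤ n i := by
        intro i hi
        have hi : (σ.symm i : ℕ) < m := by simpa [pre] using hi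
        have := hσ (show σ.symm i ≤ ⟨m, hm⟩ from hi.le)
        simpa using this
      refine (Φ.ncard_code_insert_le hN hI fun ω hω => hK ω hω _).trans ?_
      rw [cost, ← hps]
      exact mul_le_mul_of_nonneg_left (ih (by omega)) (Real.exp_pos _).le
  have h := key d le_rfl
  have e1 : pre σ d = Finset.univ := by simp [pre]
  have e2 : (Finset.univ.filter fun j : Fin d => (j : ℕ) < d) = Finset.univ := by simp
  rwa [e1, e2] at h

/-- The data (stopping times, ordering of the coordinates, symbol counts) by which
sequences are classified at time `N`. -/
abbrev TypeData (Φ : DiagIFS d A) (N : ℕ) : Type :=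
  (Fin d → Fin (N + 1)) × Equiv.Perm (Fin d) × (Fin d → Φ.Symb → Fin (N + 1))

theorem card_typeData (Φ : DiagIFS d A) (N : ℕ) : Fintype.card (Φ.TypeData N) =
    Fintype.card (Equiv.Perm (Fin d)) * (N + 1) ^ (d + d * Fintype.card Φ.Symb) := by
  simp only [TypeData, Fintype.card_prod, Fintype.card_fun, Fintype.card_fin]
  rw [pow_add, mul_comm d, pow_mul]
  ring

theorem summable_card_typeData (Φ : DiagIFS d A) {γ : ℝ} (hγ : 0 < γ) :
    Summable fun N : ℕ => (Fintype.card (Φ.TypeData N) : ℝ) * Real.exp (-γ * N) := by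
  have h := (summable_nat_add_iff 1).2
    (Real.summable_pow_mul_exp_neg_nat_mul (d + d * Fintype.card Φ.Symb) hγ)
  refine (h.mul_left (Fintype.card (Equiv.Perm (Fin d)) * Real.exp γ)).congr fun N => ?_
  rw [card_typeData]
  push_cast
  rw [show -γ * (N : ℝ) = γ + -γ * (N + 1) by ring, Real.exp_add]
  ring

/-- If every `ω` admits arbitrarily large times at which the number of approximate cubes of
its type, of size `exp (-b)`, is at most `exp (s * b)`, then the dimension is at most `s`. -/
theorem dimH_limitSet_le (Φ : DiagIFS d A) (hV : Φ.Valid) {c : ℝ} (hc : 0 < c) (s : ℝ≥0)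
    (h : ∀ ω : ℕ → Φ.Symb, ∃ᶠ N : ℕ in atTop, ∃ (n : Fin d → ℕ) (σ : Equiv.Perm (Fin d)) (b : ℝ),
      (∀ i, n i ≤ N) ∧ Antitone (n ∘ σ) ∧ c * N ≤ b ∧ (∀ i, b ≤ Φ.birkhoff ω i (n i)) ∧
        ∑ j, Φ.cost n (fun i => Φ.freq ω (n i)) σ j ≤ s * b) :
    dimH Φ.limitSet ≤ s := by
  by_contra! hlt
  obtain ⟨s', hs, hs'⟩ := ENNReal.lt_iff_exists_nnreal_btwn.1 hlt
  have hs : s < s' := by exact_mod_cast hs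
  refine hs'.not_ge (dimH_le_of_hausdorffMeasure_ne_top (ne_top_of_le_ne_top ENNReal.zero_ne_top ?_))
  let K : ∀ N, Φ.TypeData N → Set (ℕ → Φ.Symb) := fun N τ =>
    {ω | (∀ i a, Φ.count ω (τ.1 i) a = τ.2.2 i a) ∧
      Antitone ((fun i => (τ.1 i : ℕ)) ∘ τ.2.1) ∧ ∃ b : ℝ, c * N ≤ b ∧
        (∀ i, b ≤ Φ.birkhoff ω i (τ.1 i)) ∧
        ∑ j, Φ.cost (fun i => (τ.1 i : ℕ)) (fun i => Φ.freq ω (τ.1 i)) τ.2.1 j ≤ s * b}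
  let cd : ∀ N, Φ.TypeData N → (ℕ → Φ.Symb) → ((i : Fin d) → Fin N → Option (A i)) :=
    fun N τ => Φ.code (fun i => (τ.1 i : ℕ)) N Finset.univ
  let t : ∀ N, (Φ.TypeData N × ((i : Fin d) → Fin N → Option (A i))) → Set (Fin d → ℝ) :=
    fun N z => Φ.coding '' {ω ∈ K N z.1 | cd N z.1 ω = z.2}
  have hfreq : ∀ {N} {τ : Φ.TypeData N} {ω ω'}, ω ∈ K N τ → ω' ∈ K N τ → ∀ i,
      Φ.freq ω (τ.1 i) = Φ.freq ω' (τ.1 i) := by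
    intro N τ ω ω' h h' i
    funext a
    rw [freq, freq, h.1, h'.1]
  have hle : ∀ {N} {τ : Φ.TypeData N}, ∀ i, (τ.1 i : ℕ) ≤ N := fun {N τ} i =>
    Nat.lt_succ_iff.1 (τ.1 i).2
  have hdiam : ∀ {N} {τ : Φ.TypeData N} {ω₀ : ℕ → Φ.Symb} (hω₀ : ω₀ ∈ K N τ) {b : ℝ}
      (hb : ∀ i, b ≤ Φ.birkhoff ω₀ i (τ.1 i)) (z),
      ediam (t N (τ, z)) ≤ ENNReal.ofReal (Real.exp (-b)) := by
    intro N τ ω₀ hω₀ b hb z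
    refine ediam_le ?_
    rintro _ ⟨ω, ⟨hω, hz⟩, rfl⟩ _ ⟨ω', ⟨hω', hz'⟩, rfl⟩
    rw [edist_dist]
    refine ENNReal.ofReal_le_ofReal ((dist_pi_le_iff (Real.exp_pos _).le).2 fun i => ?_)
    have hag := (Φ.code_eq_iff hle).1 (hz.trans hz'.symm) i (Finset.mem_univ _)
    refine (Φ.abs_coding_sub_le hV hag).trans (Real.exp_le_exp.2 (neg_le_neg ?_))
    rw [birkhoff_eq, hfreq hω hω₀, ← birkhoff_eq]
    exact hb i
  have hsum : ∀ N (τ : Φ.TypeData N), ∑ z, ediam (t N (τ, z)) ^ (s' : ℝ) ≤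
      ENNReal.ofReal (Real.exp (-((s' - s) * c) * N)) := by
    intro N τ
    have h0 : ∀ z ∉ (cd N τ '' K N τ).toFinset, ediam (t N (τ, z)) ^ (s' : ℝ) = 0 := by
      intro z hz
      have : t N (τ, z) = ∅ := by
        refine image_eq_empty.2 (eq_empty_of_forall_notMem fun ω hω => hz ?_)
        exact Set.mem_toFinset.2 ⟨ω, hω.1, hω.2⟩
      rw [this, ediam_empty, ENNReal.zero_rpow_of_pos (by exact_mod_cast bot_le.trans_lt hs)]
    rw [← Finset.sum_subset (Finset.subset_univ (cd N τ '' K N τ).toFinset) fun z _ hz => h0 z hz]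
    rcases (K N τ).eq_empty_or_nonempty with hK | ⟨ω₀, hω₀⟩
    · simp [hK]
    obtain ⟨-, hanti, b, hcb, hb, hcost⟩ := id hω₀
    refine (Finset.sum_le_card_nsmul _ _ (ENNReal.ofReal (Real.exp (-b)) ^ (s' : ℝ)) fun z _ =>
      ENNReal.rpow_le_rpow (hdiam hω₀ hb z) s'.2).trans ?_
    rw [ENNReal.ofReal_rpow_of_pos (Real.exp_pos _), ← Set.ncard_eq_toFinset_card', nsmul_eq_mul,
      ← ENNReal.ofReal_natCast, ← ENNReal.ofReal_mul (Nat.cast_nonneg _)]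
    refine ENNReal.ofReal_le_ofReal ?_
    have hcard := Φ.ncard_code_le hle hanti (fun ω hω i => hfreq hω hω₀ i)
    rw [← Real.exp_mul]
    refine (mul_le_mul_of_nonneg_right (hcard.trans (Real.exp_le_exp.2 hcost))
      (Real.exp_pos _).le).trans ?_
    rw [← Real.exp_add, Real.exp_le_exp]
    have : (0 : ℝ) < s' - s := sub_pos.2 (by exact_mod_cast hs)
    nlinarith [mul_le_mul_of_nonneg_left hcb this.le]
  have htot : ∀ N, ∑ z, ediam (t N z) ^ (s' : ℝ) ≤
      ENNReal.ofReal (Fintype.card (Φ.TypeData N) * Real.exp (-((s' - s) * c) * N)) := by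
    intro N
    rw [Fintype.sum_prod_type, ENNReal.ofReal_mul (Nat.cast_nonneg _), ENNReal.ofReal_natCast,
      ← nsmul_eq_mul]
    exact Finset.sum_le_card_nsmul _ _ _ fun τ _ => hsum N τ
  have hsmb := Φ.summable_card_typeData
    (γ := (s' - s) * c) (mul_pos (sub_pos.2 (by exact_mod_cast hs)) hc)
  have htail := ENNReal.tendsto_sum_nat_add
    (fun N => ENNReal.ofReal (Fintype.card (Φ.TypeData N) * Real.exp (-((s' - s) * c) * N)))
    hsmb.tsum_ofReal_ne_top
  have hr : Tendsto (fun M : ℕ => ENNReal.ofReal (Real.exp (-(c * M)))) atTop (𝓝 0) := by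
    rw [← ENNReal.ofReal_zero]
    refine (ENNReal.continuous_ofReal.tendsto 0).comp (Real.tendsto_exp_neg_atTop_nhds_zero.comp ?_)
    exact tendsto_natCast_atTop_atTop.const_mul_atTop hc
  refine (Measure.hausdorffMeasure_le_liminf_tsum (ι := fun M => Σ k, Φ.TypeData (k + M) ×
    ((i : Fin d) → Fin (k + M) → Option (A i))) (s' : ℝ) Φ.limitSet _ hr
    (fun M z => t (z.1 + M) z.2) (Eventually.of_forall ?_) (Eventually.of_forall ?_)).trans ?_
  · rintro M ⟨k, τ, z⟩
    rcases (K (k + M) τ).eq_empty_or_nonempty with hK | ⟨ω₀, hω₀⟩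
    · simp [t, hK]
    obtain ⟨-, hanti, b, hcb, hb, hcost⟩ := id hω₀
    refine (hdiam hω₀ hb z).trans (ENNReal.ofReal_le_ofReal (Real.exp_le_exp.2 (neg_le_neg ?_)))
    refine le_trans (mul_le_mul_of_nonneg_left ?_ hc.le) hcb
    push_cast
    linarith [k.cast_nonneg (α := ℝ)]
  · rintro M _ ⟨ω, rfl⟩
    obtain ⟨N, hMN, n, σ, b, hn, hσ, hcb, hb, hcost⟩ := frequently_atTop.1 (h ω) M
    obtain ⟨k, rfl⟩ := Nat.exists_eq_add_of_le' hMN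
    have hcount : ∀ i a, Φ.count ω (n i) a < k + M + 1 := fun i a =>
      Nat.lt_succ_iff.2 (((Finset.card_filter_le _ _).trans (by simp)).trans (hn i))
    let τ : Φ.TypeData (k + M) := ⟨fun i => ⟨n i, Nat.lt_succ_iff.2 (hn i)⟩, σ,
      fun i a => ⟨Φ.count ω (n i) a, hcount i a⟩⟩
    exact mem_iUnion.2 ⟨⟨k, τ, cd (k + M) τ ω⟩, ω,
      ⟨⟨fun i a => rfl, hσ, b, hcb, hb, hcost⟩, rfl⟩, rfl⟩
  · refine le_trans (liminf_le_liminf (Eventually.of_forall fun M => ?_)) htail.liminf_eq.le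
    refine (ENNReal.tsum_sigma fun (k : ℕ) z => ediam (t (k + M) z) ^ (s' : ℝ)).le.trans ?_
    refine ENNReal.tsum_le_tsum fun k => ?_
    rw [tsum_fintype]
    exact htot (k + M)

end DiagIFS

/-- A Frostman bound for a nontrivial measure `ν' ≪ ν` bounds the dimension of `ν` below. -/
theorem le_measDim_of_frostman {E : Type*} [NormedAddCommGroup E] [NormedSpace ℝ E]
    [FiniteDimensional ℝ E] [MeasurableSpace E] [BorelSpace E]
    (ν ν' : Measure E) [IsFiniteMeasure ν] [IsFiniteMeasure ν'] (hac : ν' ≪ ν)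
    (h0 : ν' ≠ 0) {K ρ₀ s : ℝ} (hK : 0 < K) (hρ₀ : 0 < ρ₀)
    (h : ∀ x, ∀ ρ, 0 < ρ → ρ < ρ₀ → ν' (closedBall x ρ) ≤ ENNReal.ofReal (K * ρ ^ s)) :
    ENNReal.ofReal s ≤ measDim ν := by
  by_contra! hlt
  apply h0
  have hz : ν'.rnDeriv ν =ᵐ[ν] 0 := by
    filter_upwards [ae_lt_of_essSup_lt hlt, Besicovitch.ae_tendsto_rnDeriv ν' ν] with x hx hlim
    by_contra hpos
    obtain ⟨c, hc0, hc⟩ := ENNReal.lt_iff_exists_nnreal_btwn.1 (pos_iff_ne_zero.2 hpos)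
    have hc0 : (0 : ℝ) < c := by exact_mod_cast hc0
    have hev : ∀ᶠ r in 𝓝[>] (0 : ℝ), ν (closedBall x r) ≠ 0 ∧
        (ν (closedBall x r)).toReal ≤ K / c * r ^ s := by
      filter_upwards [hlim.eventually (lt_mem_nhds hc), Ioo_mem_nhdsGT hρ₀] with r hr hr'
      have hne : ν (closedBall x r) ≠ 0 := by
        intro h0
        rw [hac h0, ENNReal.zero_div] at hr
        exact absurd hr (by simp)
      refine ⟨hne, ?_⟩
      have h1 := (ENNReal.lt_div_iff_mul_lt (Or.inl hne) (Or.inl (measure_ne_top _ _))).1 hr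
      have h2 := h1.le.trans (h x r hr'.1 hr'.2)
      have h3 := ENNReal.toReal_mono ENNReal.ofReal_ne_top h2
      rw [ENNReal.toReal_mul, ENNReal.toReal_ofReal (by have := hr'.1; positivity)] at h3
      rw [div_mul_eq_mul_div, le_div_iff₀ hc0, mul_comm]
      exact h3
    have hhalf : Tendsto (fun r : ℝ => r / 2) (𝓝[>] 0) (𝓝[>] 0) := by
      refine tendsto_nhdsWithin_iff.2 ⟨?_, ?_⟩
      · have : Tendsto (fun r : ℝ => r / 2) (𝓝 0) (𝓝 (0 / 2)) := tendsto_id.div_const 2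
        rw [zero_div] at this
        exact this.mono_left nhdsWithin_le_nhds
      · filter_upwards [self_mem_nhdsWithin] with r hr using half_pos (mem_Ioi.1 hr)
    have hbd : ∀ᶠ r in 𝓝[>] (0 : ℝ), ENNReal.ofReal (s + Real.log (K / c) / Real.log r) ≤
        ENNReal.ofReal (Real.log (ν (ball x r)).toReal / Real.log r) := by
      filter_upwards [hev, hhalf.eventually hev, Ioo_mem_nhdsGT one_pos] with r h1 h2 hr
      have hlog := Real.log_neg hr.1 hr.2
      refine ENNReal.ofReal_le_ofReal ?_
      rw [le_div_iff_of_neg hlog, add_mul, div_mul_cancel₀ _ hlog.ne, add_comm,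
        ← Real.log_rpow hr.1, ← Real.log_mul (by positivity) (Real.rpow_pos_of_pos hr.1 _).ne']
      refine Real.log_le_log (ENNReal.toReal_pos ?_ (measure_ne_top _ _)) ?_
      · intro h0
        exact h2.1 (measure_mono_null (closedBall_subset_ball (half_lt_self hr.1)) h0)
      · exact (ENNReal.toReal_mono (measure_ne_top _ _)
          (measure_mono ball_subset_closedBall)).trans h1.2
    have hlim' : Tendsto (fun r : ℝ => ENNReal.ofReal (s + Real.log (K / c) / Real.log r))
        (𝓝[>] 0) (𝓝 (ENNReal.ofReal s)) := by
      refine (ENNReal.continuous_ofReal.tendsto s).comp ?_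
      have := (Real.tendsto_log_nhdsGT_zero.const_div_atBot (Real.log (K / c))).const_add s
      rwa [add_zero] at this
    exact hx.not_ge (hlim'.liminf_eq.symm.le.trans (liminf_le_liminf hbd))
  rw [← Measure.withDensity_rnDeriv_eq ν' ν hac, withDensity_congr_ae hz, withDensity_zero]

namespace DiagIFS

/-- `ω` and `ω'` have the same symbols in the coordinates `J` before time `m` and in the
coordinates `I` before time `n`. -/
def SameCube (Φ : DiagIFS d A) (I J : Finset (Fin d)) (m n : ℕ) (ω ω' : ℕ → Φ.Symb) : Prop :=
  (∀ k < m, ∀ i ∈ J, (ω' k).1 i = (ω k).1 i) ∧ ∀ k < n, ∀ i ∈ I, (ω' k).1 i = (ω k).1 i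

/-- An interval of length `ρ` near `coding ω i` inside the cylinder interval. -/
theorem exists_Ioo_subset_cylMap (Φ : DiagIFS d A) (hV : Φ.Valid) (ω : ℕ → Φ.Symb) (i : Fin d)
    (n : ℕ) {ρ : ℝ} (hρ₀ : 0 < ρ) (hρ : ρ ≤ Real.exp (-Φ.birkhoff ω i n)) :
    ∃ u, Φ.coding ω i - ρ ≤ u ∧ u ≤ Φ.coding ω i ∧
      Ioo u (u + ρ) ⊆ Φ.cylMap ω i n '' Ioo (0 : ℝ) 1 := by
  rw [← Φ.abs_slopeProd hV] at hρ
  have hy := Φ.coding_mem_Icc hV (fun k => ω (k + n)) i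
  rw [Φ.coding_eq_cylMap hV ω i n]
  set y := Φ.coding (fun k => ω (k + n)) i
  have hs := Φ.slopeProd_ne_zero hV ω i n
  simp only [cylMap]
  set S := ∑ k ∈ Finset.range n, Φ.slopeProd ω i k * Φ.off i ((ω k).1 i)
  set l := Φ.slopeProd ω i n
  have key : ∀ z, (z - S) / l ∈ Ioo (0 : ℝ) 1 → z ∈ (fun x => S + l * x) '' Ioo (0 : ℝ) 1 :=
    fun z hz => ⟨_, hz, by field_simp; ring⟩
  rcases hs.lt_or_gt with hl | hl
  · rw [abs_of_neg hl] at hρ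
    refine ⟨min (S + l * y) (S - ρ), le_min (by linarith) (by nlinarith [hy.1]),
      min_le_left _ _, fun z hz => key z ⟨?_, ?_⟩⟩
    · refine div_pos_of_neg_of_neg ?_ hl
      linarith [hz.2, min_le_right (S + l * y) (S - ρ)]
    · rw [div_lt_one_of_neg hl]
      have : S + l ≤ min (S + l * y) (S - ρ) := le_min (by nlinarith [hy.2]) (by linarith)
      linarith [hz.1]
  · rw [abs_of_pos hl] at hρ
    refine ⟨min (S + l * y) (S + l - ρ), le_min (by linarith) (by nlinarith [hy.2]),
      min_le_left _ _, fun z hz => key z ⟨?_, ?_⟩⟩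
    · refine div_pos ?_ hl
      have : S ≤ min (S + l * y) (S + l - ρ) := le_min (by nlinarith [hy.1]) (by linarith)
      linarith [hz.1]
    · rw [div_lt_one hl]
      linarith [hz.2, min_le_right (S + l * y) (S + l - ρ)]

theorem sameCube_of_not_disjoint (Φ : DiagIFS d A) (hV : Φ.Valid) {I J : Finset (Fin d)}
    (hI : Φ.GoodIdx I) (hJ : Φ.GoodIdx J) (hIJ : I ⊆ J) {m n : ℕ} (hmn : m ≤ n)
    {ω ω' : ℕ → Φ.Symb}
    (h : ∀ i ∈ J, ¬ Disjoint (Φ.cylMap ω i (if i ∈ I then n else m) '' Ioo (0 : ℝ) 1)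
      (Φ.cylMap ω' i (if i ∈ I then n else m) '' Ioo (0 : ℝ) 1)) :
    Φ.SameCube I J m n ω ω' := by
  have key : ∀ k, (k < m → ∀ i ∈ J, (ω' k).1 i = (ω k).1 i) ∧
      (k < n → ∀ i ∈ I, (ω' k).1 i = (ω k).1 i) := by
    intro k
    induction k using Nat.strong_induction_on with
    | _ k ih =>
    constructor
    · intro hk
      by_contra! hne
      obtain ⟨i, hi, hd⟩ := hJ _ (ω' k).2 _ (ω k).2 hne
      refine h i hi (Φ.disjoint_cylMap_image hV (k := k) ?_
        (fun j hj => ((ih j hj).1 (hj.trans hk) i hi).symm) hd.symm)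
      split_ifs <;> omega
    · intro hk
      by_contra! hne
      obtain ⟨i, hi, hd⟩ := hI _ (ω' k).2 _ (ω k).2 hne
      refine h i (hIJ hi) (Φ.disjoint_cylMap_image hV (k := k) (by rwa [if_pos hi])
        (fun j hj => ((ih j hj).2 (hj.trans hk) i hi).symm) hd.symm)
  exact ⟨fun k hk => (key k).1 hk, fun k hk => (key k).2 hk⟩

/-- A ball of radius `ρ` meets at most `4 ^ d` cubes whose sides are at least `ρ`. -/
theorem measure_inter_closedBall_le (Φ : DiagIFS d A) (hV : Φ.Valid) {I J : Finset (Fin d)}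
    (hI : Φ.GoodIdx I) (hJ : Φ.GoodIdx J) (hIJ : I ⊆ J) {m n : ℕ} (hmn : m ≤ n)
    (μ : Measure (ℕ → Φ.Symb)) {G : Set (ℕ → Φ.Symb)} {ρ : ℝ} (hρ : 0 < ρ) {M : ℝ≥0∞}
    (hGI : ∀ ω ∈ G, ∀ i ∈ I, ρ ≤ Real.exp (-Φ.birkhoff ω i n))
    (hGJ : ∀ ω ∈ G, ∀ i ∈ J, ρ ≤ Real.exp (-Φ.birkhoff ω i m))
    (hM : ∀ ω ∈ G, μ {ω' | Φ.SameCube I J m n ω ω'} ≤ M) (x : Fin d → ℝ) :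
    μ (Φ.coding ⁻¹' closedBall x ρ ∩ G) ≤ 4 ^ d * M := by
  let t : Fin d → ℕ := fun i => if i ∈ I then n else m
  have hu : ∀ ω : ℕ → Φ.Symb, ∃ u : Fin d → ℝ, ω ∈ Φ.coding ⁻¹' closedBall x ρ ∩ G → ∀ i ∈ J,
      x i - 2 * ρ ≤ u i ∧ u i ≤ x i + ρ ∧
        Ioo (u i) (u i + ρ) ⊆ Φ.cylMap ω i (t i) '' Ioo (0 : ℝ) 1 := by
    intro ω
    by_cases hω : ω ∈ Φ.coding ⁻¹' closedBall x ρ ∩ G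
    swap
    · exact ⟨0, fun h => absurd h hω⟩
    have : ∀ i, ∃ u : ℝ, i ∈ J → x i - 2 * ρ ≤ u ∧ u ≤ x i + ρ ∧
        Ioo u (u + ρ) ⊆ Φ.cylMap ω i (t i) '' Ioo (0 : ℝ) 1 := by
      intro i
      by_cases hi : i ∈ J
      swap
      · exact ⟨0, fun h => absurd h hi⟩
      have hle : ρ ≤ Real.exp (-Φ.birkhoff ω i (t i)) := by
        simp only [t]
        split_ifs with h
        · exact hGI ω hω.2 i h
        · exact hGJ ω hω.2 i hi
      obtain ⟨u, h1, h2, h3⟩ := Φ.exists_Ioo_subset_cylMap hV ω i (t i) hρ hle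
      have hd : |Φ.coding ω i - x i| ≤ ρ := (dist_le_pi_dist _ x i).trans hω.1
      rw [abs_le] at hd
      exact ⟨u, fun _ => ⟨by linarith, by linarith, h3⟩⟩
    choose u hu using this
    exact ⟨u, fun _ i hi => hu i hi⟩
  choose u hu using hu
  let key : (ℕ → Φ.Symb) → Fin d → ℕ := fun ω i =>
    if i ∈ J then ⌊(u ω i - (x i - 2 * ρ)) / ρ⌋₊ else 0
  have hkey : ∀ ω ∈ Φ.coding ⁻¹' closedBall x ρ ∩ G, ∀ i, key ω i < 4 := by
    intro ω hω i
    simp only [key]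
    split_ifs with hi
    · obtain ⟨h1, h2, -⟩ := hu ω hω i hi
      rw [Nat.floor_lt (div_nonneg (by linarith) hρ.le), div_lt_iff₀ hρ]
      push_cast
      linarith
    · norm_num
  have hcov : Φ.coding ⁻¹' closedBall x ρ ∩ G ⊆ ⋃ κ : Fin d → Fin 4,
      {ω ∈ Φ.coding ⁻¹' closedBall x ρ ∩ G | ∀ i, key ω i = κ i} := fun ω hω =>
    mem_iUnion.2 ⟨fun i => ⟨key ω i, hkey ω hω i⟩, hω, fun i => rfl⟩
  have hpiece : ∀ κ : Fin d → Fin 4,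
      μ {ω ∈ Φ.coding ⁻¹' closedBall x ρ ∩ G | ∀ i, key ω i = κ i} ≤ M := by
    intro κ
    rcases Set.eq_empty_or_nonempty
      {ω ∈ Φ.coding ⁻¹' closedBall x ρ ∩ G | ∀ i, key ω i = κ i} with he | ⟨ω₀, hω₀, hκ₀⟩
    · rw [he, measure_empty]
      exact bot_le
    refine (measure_mono fun ω hω => ?_).trans (hM ω₀ hω₀.2)
    refine Φ.sameCube_of_not_disjoint hV hI hJ hIJ hmn fun i hi hdisj => ?_
    obtain ⟨a1, -, a3⟩ := hu ω₀ hω₀ i hi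
    obtain ⟨b1, -, b3⟩ := hu ω hω.1 i hi
    have hfl : ⌊(u ω₀ i - (x i - 2 * ρ)) / ρ⌋₊ = ⌊(u ω i - (x i - 2 * ρ)) / ρ⌋₊ := by
      have := (hκ₀ i).trans (hω.2 i).symm
      simpa only [key, if_pos hi] using this
    have l1 := Nat.floor_le (div_nonneg (sub_nonneg.2 a1) hρ.le)
    have l2 := Nat.lt_floor_add_one ((u ω₀ i - (x i - 2 * ρ)) / ρ)
    have l3 := Nat.floor_le (div_nonneg (sub_nonneg.2 b1) hρ.le)
    have l4 := Nat.lt_floor_add_one ((u ω i - (x i - 2 * ρ)) / ρ)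
    rw [hfl] at l1 l2
    rw [le_div_iff₀ hρ] at l1 l3
    rw [div_lt_iff₀ hρ] at l2 l4
    have hlt : max (u ω₀ i) (u ω i) < min (u ω₀ i + ρ) (u ω i + ρ) :=
      max_lt (lt_min (by linarith) (by linarith)) (lt_min (by linarith) (by linarith))
    obtain ⟨z, hz1, hz2⟩ := exists_between hlt
    exact Set.disjoint_left.1 hdisj
      (a3 ⟨(le_max_left _ _).trans_lt hz1, hz2.trans_le (min_le_left _ _)⟩)
      (b3 ⟨(le_max_right _ _).trans_lt hz1, hz2.trans_le (min_le_right _ _)⟩)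
  refine (measure_mono hcov).trans ((measure_iUnion_fintype_le _ _).trans ?_)
  refine (Finset.sum_le_card_nsmul _ _ _ fun κ _ => hpiece κ).trans (le_of_eq ?_)
  simp

/-- the probability measure on the alphabet with density `p` -/
noncomputable def letterMeasure (Φ : DiagIFS d A) (p : Φ.Symb → ℝ) : Measure Φ.Symb :=
  ∑ a, ENNReal.ofReal (p a) • Measure.dirac a

theorem letterMeasure_apply (Φ : DiagIFS d A) {p : Φ.Symb → ℝ} (hp : ∀ a, 0 ≤ p a)
    (s : Set Φ.Symb) :
    Φ.letterMeasure p s = ENNReal.ofReal (∑ a, if a ∈ s then p a else 0) := by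
  rw [letterMeasure, Measure.finsetSum_apply, ENNReal.ofReal_sum_of_nonneg]
  · refine Finset.sum_congr rfl fun a _ => ?_
    by_cases h : a ∈ s <;> simp [h]
  · intro a _
    split_ifs <;> simp [hp a]

theorem isProbabilityMeasure_letterMeasure (Φ : DiagIFS d A) {p : Φ.Symb → ℝ} (hp : IsProbVec p) :
    IsProbabilityMeasure (Φ.letterMeasure p) :=
  ⟨by simp only [Φ.letterMeasure_apply hp.1, mem_univ, if_true, hp.2, ENNReal.ofReal_one]⟩

theorem integral_letterMeasure (Φ : DiagIFS d A) {p : Φ.Symb → ℝ} (hp : ∀ a, 0 ≤ p a)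
    (g : Φ.Symb → ℝ) : ∫ a, g a ∂Φ.letterMeasure p = ∑ a, p a * g a := by
  rw [letterMeasure, integral_finsetSum_measure fun a _ =>
    (integrable_dirac (by simp)).smul_measure ENNReal.ofReal_ne_top]
  simp [integral_smul_measure, hp]

/-- the Bernoulli measure with letter distribution `p` -/
noncomputable def bernoulli (Φ : DiagIFS d A) (p : Φ.Symb → ℝ) (hp : IsProbVec p) :
    Measure (ℕ → Φ.Symb) :=
  haveI := Φ.isProbabilityMeasure_letterMeasure hp
  Measure.infinitePi fun _ => Φ.letterMeasure p

instance (Φ : DiagIFS d A) (p : Φ.Symb → ℝ) (hp : IsProbVec p) :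
    IsProbabilityMeasure (Φ.bernoulli p hp) := by
  have := Φ.isProbabilityMeasure_letterMeasure hp
  unfold bernoulli
  infer_instance

theorem map_shift_bernoulli (Φ : DiagIFS d A) (p : Φ.Symb → ℝ) (hp : IsProbVec p) :
    Measure.map shift (Φ.bernoulli p hp) = Φ.bernoulli p hp := by
  have := Φ.isProbabilityMeasure_letterMeasure hp
  exact Measure.map_infinitePi_infinitePi_of_inj (P := fun _ : ℕ => Φ.letterMeasure p)
    (f := fun n : ℕ => n + 1) (add_left_injective 1)

theorem ae_tendsto_average (Φ : DiagIFS d A) (p : Φ.Symb → ℝ) (hp : IsProbVec p)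
    (g : Φ.Symb → ℝ) : ∀ᵐ ω ∂Φ.bernoulli p hp, Tendsto
      (fun n : ℕ => (∑ k ∈ Finset.range n, g (ω k)) / n) atTop (𝓝 (∑ a, p a * g a)) := by
  have := Φ.isProbabilityMeasure_letterMeasure hp
  have hg : Measurable g := measurable_of_countable g
  have hmp : ∀ k, MeasurePreserving (fun ω : ℕ → Φ.Symb => ω k) (Φ.bernoulli p hp)
    (Φ.letterMeasure p) := fun k =>
      measurePreserving_eval_infinitePi (fun _ : ℕ => Φ.letterMeasure p) k
  have hgi : Integrable g (Φ.letterMeasure p) := Integrable.of_finite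
  have h := ProbabilityTheory.strong_law_ae_real (μ := Φ.bernoulli p hp) (fun k ω => g (ω k))
    ((hmp 0).integrable_comp_of_integrable hgi) ?_ ?_
  · have e : ∫ ω, g (ω 0) ∂Φ.bernoulli p hp = ∑ a, p a * g a := by
      rw [← Φ.integral_letterMeasure hp.1, ← (hmp 0).map_eq,
        integral_map (hmp 0).measurable.aemeasurable hg.aestronglyMeasurable]
    rwa [e] at h
  · intro i j hij
    exact (ProbabilityTheory.iIndepFun_infinitePi (P := fun _ : ℕ => Φ.letterMeasure p)
      (X := fun _ => g) fun _ => hg).indepFun hij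
  · intro i
    refine ⟨(hg.comp (hmp i).measurable).aemeasurable, (hg.comp (hmp 0).measurable).aemeasurable, ?_⟩
    change Measure.map (g ∘ fun ω : ℕ → Φ.Symb => ω i) _ = Measure.map (g ∘ fun ω : ℕ → Φ.Symb => ω 0) _
    rw [← Measure.map_map hg (hmp i).measurable, ← Measure.map_map hg (hmp 0).measurable,
      (hmp i).map_eq, (hmp 0).map_eq]

theorem bernoulli_sameCube_le (Φ : DiagIFS d A) (p : Φ.Symb → ℝ) (hp : IsProbVec p)
    (I J : Finset (Fin d)) {m n : ℕ} (hmn : m ≤ n) (ω : ℕ → Φ.Symb) :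
    Φ.bernoulli p hp {ω' | Φ.SameCube I J m n ω ω'} ≤ ENNReal.ofReal (Real.exp
      (∑ k ∈ Finset.range m, Real.log (Φ.cylMass J p (ω k)) +
        (∑ k ∈ Finset.range n, Real.log (Φ.cylMass I p (ω k)) -
          ∑ k ∈ Finset.range m, Real.log (Φ.cylMass I p (ω k))))) := by
  have := Φ.isProbabilityMeasure_letterMeasure hp
  let T : ℕ → Finset (Fin d) := fun k => if k < m then J else I
  have hsub : {ω' | Φ.SameCube I J m n ω ω'} ⊆ Set.pi (Finset.range n)
      fun k => {b : Φ.Symb | ∀ i ∈ T k, b.1 i = (ω k).1 i} := by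
    intro ω' h k hk i hi
    simp only [T] at hi
    split_ifs at hi with hkm
    · exact h.1 k hkm i hi
    · exact h.2 k (by simpa using hk) i hi
  have hpi := Measure.infinitePi_pi (μ := fun _ : ℕ => Φ.letterMeasure p) (s := Finset.range n)
    (t := fun k => {b : Φ.Symb | ∀ i ∈ T k, b.1 i = (ω k).1 i}) fun _ _ => MeasurableSet.of_discrete
  refine (measure_mono hsub).trans (hpi.trans_le ?_)
  have hmass : ∀ k, Φ.letterMeasure p {b : Φ.Symb | ∀ i ∈ T k, b.1 i = (ω k).1 i} =
      ENNReal.ofReal (Φ.cylMass (T k) p (ω k)) := fun k => by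
    rw [Φ.letterMeasure_apply hp.1, cylMass]
    refine congrArg _ (Finset.sum_congr rfl fun b _ => ?_)
    simp only [mem_ofPred_eq]
    congr
  simp only [hmass]
  rw [← ENNReal.ofReal_prod_of_nonneg fun k _ => Φ.cylMass_nonneg hp.1 _ _]
  refine ENNReal.ofReal_le_ofReal ?_
  rw [← Finset.sum_Ico_eq_sub _ hmn, Real.exp_add, Real.exp_sum, Real.exp_sum,
    ← Finset.prod_range_mul_prod_Ico _ hmn]
  refine mul_le_mul ?_ ?_ (Finset.prod_nonneg fun k _ => Φ.cylMass_nonneg hp.1 _ _)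
    (Finset.prod_nonneg fun k _ => (Real.exp_pos _).le)
  · refine Finset.prod_le_prod (fun k _ => Φ.cylMass_nonneg hp.1 _ _) fun k hk => ?_
    simp only [T, if_pos (Finset.mem_range.1 hk)]
    exact Real.le_exp_log _
  · refine Finset.prod_le_prod (fun k _ => Φ.cylMass_nonneg hp.1 _ _) fun k hk => ?_
    simp only [T, if_neg (Finset.mem_Ico.1 hk).1.not_gt]
    exact Real.le_exp_log _

end DiagIFS

theorem tendsto_comp_floor_div {u : ℕ → ℝ} {e t : ℝ} (ht : 0 < t)
    (hu : Tendsto (fun n : ℕ => u n / n) atTop (𝓝 e)) :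
    Tendsto (fun L : ℝ => u ⌊t * L⌋₊ / L) atTop (𝓝 (t * e)) := by
  have hfl : Tendsto (fun L : ℝ => ⌊t * L⌋₊) atTop atTop :=
    tendsto_nat_floor_atTop.comp (tendsto_id.const_mul_atTop ht)
  refine ((tendsto_nat_floor_mul_div_atTop ht.le).mul (hu.comp hfl)).congr' ?_
  filter_upwards [hfl.eventually_gt_atTop 0] with L hL
  have : ((⌊t * L⌋₊ : ℕ) : ℝ) ≠ 0 := by positivity
  simp only [Function.comp]
  field_simp

namespace DiagIFS

theorem chi_eq (Φ : DiagIFS d A) (i : Fin d) (p : Φ.Symb → ℝ) :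
    Φ.chi i p = ∑ a, p a * Φ.rate i a := by
  simp [chi, rate]

theorem measDim_map_coding_le_dynDim (Φ : DiagIFS d A) (p : Φ.Symb → ℝ) (hp : IsProbVec p) :
    measDim (Measure.map Φ.coding (Φ.bernoulli p hp)) ≤ Φ.dynDim :=
  le_sSup ⟨_, inferInstance, Φ.map_shift_bernoulli p hp, rfl⟩

/-- A lower bound for the dimension of a Bernoulli measure, using only two scales. -/
theorem le_dynDim_of_goodIdx (Φ : DiagIFS d A) (hV : Φ.Valid) {p : Φ.Symb → ℝ} (hp : IsProbVec p)
    {I J : Finset (Fin d)} (hI : Φ.GoodIdx I) (hJ : Φ.GoodIdx J) (hIJ : I ⊆ J) {s t : ℝ}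
    (hs : 0 < s) (hst : s ≤ t) (ht : ∀ i ∈ I, t * Φ.chi i p ≤ 1) (hs' : ∀ i ∈ J, s * Φ.chi i p ≤ 1) :
    ENNReal.ofReal (s * Φ.entropy J p + (t - s) * Φ.entropy I p) ≤ Φ.dynDim := by
  have ht0 : 0 < t := hs.trans_le hst
  set δ := s * Φ.entropy J p + (t - s) * Φ.entropy I p with hδ
  suffices h : ∀ ε > 0, ENNReal.ofReal ((δ - ε) / (1 + ε)) ≤ Φ.dynDim by
    have hlim : Tendsto (fun ε : ℝ => ENNReal.ofReal ((δ - ε) / (1 + ε))) (𝓝[>] 0)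
        (𝓝 (ENNReal.ofReal δ)) := by
      have h1 : ContinuousAt (fun ε : ℝ => (δ - ε) / (1 + ε)) 0 :=
        ContinuousAt.div (by fun_prop) (by fun_prop) (by norm_num)
      have h2 := (ENNReal.continuous_ofReal.continuousAt.comp h1).tendsto
      simp only [Function.comp, sub_zero, add_zero, div_one] at h2
      exact h2.mono_left nhdsWithin_le_nhds
    exact le_of_tendsto hlim (by filter_upwards [self_mem_nhdsWithin] with ε hε using h ε hε)
  intro ε hε
  set μ := Φ.bernoulli p hp
  let ex : (ℕ → Φ.Symb) → ℝ → ℝ := fun ω L =>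
    ∑ k ∈ Finset.range ⌊s * L⌋₊, Real.log (Φ.cylMass J p (ω k)) +
      (∑ k ∈ Finset.range ⌊t * L⌋₊, Real.log (Φ.cylMass I p (ω k)) -
        ∑ k ∈ Finset.range ⌊s * L⌋₊, Real.log (Φ.cylMass I p (ω k)))
  let G : ℕ → Set (ℕ → Φ.Symb) := fun N => {ω | ∀ L : ℝ, (N : ℝ) ≤ L → 0 < L →
    (∀ i ∈ I, Φ.birkhoff ω i ⌊t * L⌋₊ ≤ (1 + ε) * L) ∧
    (∀ i ∈ J, Φ.birkhoff ω i ⌊s * L⌋₊ ≤ (1 + ε) * L) ∧ ex ω L ≤ -(δ - ε) * L}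
  have hG : ∀ᵐ ω ∂μ, ω ∈ ⋃ N, G N := by
    filter_upwards [ae_all_iff.2 fun i => Φ.ae_tendsto_average p hp (Φ.rate i),
      Φ.ae_tendsto_average p hp fun a => Real.log (Φ.cylMass I p a),
      Φ.ae_tendsto_average p hp fun a => Real.log (Φ.cylMass J p a)] with ω h1 h2 h3
    have hb : ∀ {r : ℝ} {K : Finset (Fin d)}, 0 < r → (∀ i ∈ K, r * Φ.chi i p ≤ 1) →
        ∀ᶠ L : ℝ in atTop, ∀ i ∈ K, Φ.birkhoff ω i ⌊r * L⌋₊ / L < 1 + ε := by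
      intro r K hr hK
      refine (Filter.eventually_all_finset K).2 fun i hi => ?_
      refine (tendsto_comp_floor_div hr (h1 i)).eventually (gt_mem_nhds ?_)
      rw [← chi_eq]
      linarith [hK i hi]
    have hex : ∀ᶠ L : ℝ in atTop, ex ω L / L < -(δ - ε) := by
      have := (tendsto_comp_floor_div hs h3).add
        ((tendsto_comp_floor_div ht0 h2).sub (tendsto_comp_floor_div hs h2))
      simp only [← sub_div, ← add_div] at this
      refine this.eventually (gt_mem_nhds ?_)
      rw [hδ, entropy, entropy]
      linarith
    obtain ⟨L₀, hL₀⟩ := eventually_atTop.1 ((hb ht0 ht).and ((hb hs hs').and hex))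
    obtain ⟨N, hN⟩ := exists_nat_ge L₀
    refine mem_iUnion.2 ⟨N, fun L hL hL0 => ?_⟩
    obtain ⟨a1, a2, a3⟩ := hL₀ L (hN.trans hL)
    exact ⟨fun i hi => ((div_lt_iff₀ hL0).1 (a1 i hi)).le,
      fun i hi => ((div_lt_iff₀ hL0).1 (a2 i hi)).le, ((div_lt_iff₀ hL0).1 a3).le⟩
  obtain ⟨N, hN⟩ : ∃ N, μ (G N) ≠ 0 := by
    by_contra! hz
    have h0 : μ (⋃ N, G N) = 0 := measure_iUnion_null hz
    have h1 : ∀ᵐ ω ∂μ, ω ∉ ⋃ N, G N := measure_eq_zero_iff_ae_notMem.1 h0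
    obtain ⟨ω, hω⟩ := (hG.and h1).exists
    exact hω.2 hω.1
  have hm := Φ.measurable_coding hV
  refine le_trans ?_ (Φ.measDim_map_coding_le_dynDim p hp)
  refine le_measDim_of_frostman _ (Measure.map Φ.coding (μ.restrict (G N)))
    (Measure.map_mono_of_aemeasurable Measure.restrict_le_self hm.aemeasurable).absolutelyContinuous
    ?_ (K := 4 ^ d) (ρ₀ := Real.exp (-((1 + ε) * max (N : ℝ) 1))) (by positivity) (Real.exp_pos _) ?_
  · rw [Ne, Measure.map_eq_zero_iff hm.aemeasurable, Measure.restrict_eq_zero]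
    exact hN
  intro x ρ hρ hρ'
  rw [Measure.map_apply hm measurableSet_closedBall,
    Measure.restrict_apply (hm measurableSet_closedBall)]
  obtain ⟨L, hL⟩ : ∃ L, L = -Real.log ρ / (1 + ε) := ⟨_, rfl⟩
  have hε1 : 0 < 1 + ε := by linarith
  have hρL : ρ = Real.exp (-((1 + ε) * L)) := by
    rw [hL, mul_div_cancel₀ _ hε1.ne', neg_neg, Real.exp_log hρ]
  have hLN : max (N : ℝ) 1 ≤ L := by
    rw [hρL, Real.exp_lt_exp, neg_lt_neg_iff] at hρ'
    exact (lt_of_mul_lt_mul_left hρ' hε1.le).le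
  have hL0 : 0 < L := one_pos.trans_le ((le_max_right _ _).trans hLN)
  have hmem : ∀ ω ∈ G N, _ := fun ω hω => hω L ((le_max_left _ _).trans hLN) hL0
  refine (Φ.measure_inter_closedBall_le hV hI hJ hIJ (m := ⌊s * L⌋₊) (n := ⌊t * L⌋₊)
    (Nat.floor_mono (mul_le_mul_of_nonneg_right hst hL0.le)) μ hρ
    (M := ENNReal.ofReal (Real.exp (-(δ - ε) * L))) ?_ ?_ ?_ x).trans (le_of_eq ?_)
  · intro ω hω i hi
    rw [hρL]
    exact Real.exp_le_exp.2 (neg_le_neg ((hmem ω hω).1 i hi))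
  · intro ω hω i hi
    rw [hρL]
    exact Real.exp_le_exp.2 (neg_le_neg ((hmem ω hω).2.1 i hi))
  · intro ω hω
    refine (Φ.bernoulli_sameCube_le p hp I J
      (Nat.floor_mono (mul_le_mul_of_nonneg_right hst hL0.le)) ω).trans ?_
    exact ENNReal.ofReal_le_ofReal (Real.exp_le_exp.2 (hmem ω hω).2.2)
  · rw [ENNReal.ofReal_mul (by positivity), ENNReal.ofReal_pow (by norm_num),
      ENNReal.ofReal_ofNat, hρL, ← Real.exp_mul]
    have e : -((1 + ε) * L) * ((δ - ε) / (1 + ε)) = -(δ - ε) * L := by field_simp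
    rw [e]

/-- The lower bound on the dynamical dimension of a good sponge for arbitrary coordinate sets. -/
theorem le_dynDim (Φ : DiagIFS d A) (hV : Φ.Valid)
    (hGood : ∀ p : Φ.Symb → ℝ, IsProbVec p → Φ.GoodVec p) {p : Φ.Symb → ℝ} (hp : IsProbVec p)
    {I J : Finset (Fin d)} {s t : ℝ}
    (hs : 0 < s) (hst : s ≤ t) (ht : ∀ i ∈ I, t * Φ.chi i p ≤ 1) (hs' : ∀ i ∈ J, s * Φ.chi i p ≤ 1) :
    ENNReal.ofReal (s * Φ.entropy J p + (t - s) * Φ.entropy I p) ≤ Φ.dynDim := by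
  have ht0 : 0 < t := hs.trans_le hst
  have hmem : ∀ {r : ℝ} (hr : 0 < r) {i}, i ∈ (Finset.univ.filter fun i => Φ.chi i p ≤ r⁻¹) ↔
      r * Φ.chi i p ≤ 1 := by
    intro r hr i
    rw [Finset.mem_filter, mul_comm, ← le_div_iff₀ hr, one_div]
    simp
  refine le_trans (ENNReal.ofReal_le_ofReal ?_) (Φ.le_dynDim_of_goodIdx hV hp
    (hGood p hp t⁻¹ (inv_pos.2 ht0)) (hGood p hp s⁻¹ (inv_pos.2 hs)) (fun i hi => ?_) hs hst
    (fun i hi => (hmem ht0).1 hi) (fun i hi => (hmem hs).1 hi))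
  · refine add_le_add (mul_le_mul_of_nonneg_left (Φ.entropy_mono hp.1 fun i hi => ?_) hs.le)
      (mul_le_mul_of_nonneg_left (Φ.entropy_mono hp.1 fun i hi => ?_) (sub_nonneg.2 hst))
    · exact (hmem hs).2 (hs' i hi)
    · exact (hmem ht0).2 (ht i hi)
  · rw [Finset.mem_filter] at hi ⊢
    exact ⟨hi.1, hi.2.trans (inv_anti₀ hs hst)⟩

/-- `S` is an upper bound for all two-scale lower bounds for the dynamical dimension. -/
def TwoScaleBound (Φ : DiagIFS d A) (S : ℝ) : Prop :=
  ∀ p : Φ.Symb → ℝ, IsProbVec p → ∀ (I J : Finset (Fin d)) (s t : ℝ), 0 < s → s ≤ t →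
    (∀ i ∈ I, t * Φ.chi i p ≤ 1) → (∀ i ∈ J, s * Φ.chi i p ≤ 1) →
      s * Φ.entropy J p + (t - s) * Φ.entropy I p ≤ S

theorem dynDim_ne_top (Φ : DiagIFS d A) (hV : Φ.Valid) : Φ.dynDim ≠ ⊤ := by
  refine ne_top_of_le_ne_top ?_ ((Φ.dynDim_le_dimH hV).trans (dimH_mono (subset_univ _)))
  rw [Real.dimH_univ_pi]
  exact ENNReal.natCast_ne_top _

theorem twoScaleBound_dynDim (Φ : DiagIFS d A) (hV : Φ.Valid)
    (hGood : ∀ p : Φ.Symb → ℝ, IsProbVec p → Φ.GoodVec p) : Φ.TwoScaleBound Φ.dynDim.toReal :=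
  fun _ hp _ _ _ _ hs hst ht hs' => (ENNReal.ofReal_le_iff_le_toReal (Φ.dynDim_ne_top hV)).1
    (Φ.le_dynDim hV hGood hp hs hst ht hs')

theorem birkhoff_mono (Φ : DiagIFS d A) {c : ℝ} (hc : 0 < c) (h : ∀ i a, c ≤ Φ.rate i a)
    (ω : ℕ → Φ.Symb) (i : Fin d) : StrictMono (Φ.birkhoff ω i) :=
  strictMono_nat_of_lt_succ fun n => by
    rw [birkhoff, birkhoff, Finset.sum_range_succ]
    linarith [h i (ω n)]

theorem le_birkhoff (Φ : DiagIFS d A) {c : ℝ} (h : ∀ i a, c ≤ Φ.rate i a)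
    (ω : ℕ → Φ.Symb) (i : Fin d) (n : ℕ) : c * n ≤ Φ.birkhoff ω i n := by
  have := Finset.card_nsmul_le_sum (Finset.range n) (fun k => Φ.rate i (ω k)) c fun k _ => h i _
  rw [Finset.card_range, nsmul_eq_mul] at this
  rw [birkhoff]
  linarith

theorem birkhoff_le (Φ : DiagIFS d A) {C : ℝ} (h : ∀ i a, Φ.rate i a ≤ C)
    (ω : ℕ → Φ.Symb) (i : Fin d) (n : ℕ) : Φ.birkhoff ω i n ≤ C * n := by
  have := Finset.sum_le_card_nsmul (Finset.range n) (fun k => Φ.rate i (ω k)) C fun k _ => h i _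
  rw [Finset.card_range, nsmul_eq_mul] at this
  rw [birkhoff]
  linarith

/-- The stopping times at which all coordinates have contracted by about `exp (-b)`, where `b` is
the contraction rate at time `N` of the least contracted coordinate. -/
theorem exists_stopping [NeZero d] (Φ : DiagIFS d A) {c C : ℝ} (hc : 0 < c)
    (h : ∀ i a, c ≤ Φ.rate i a ∧ Φ.rate i a ≤ C) (ω : ℕ → Φ.Symb) (N : ℕ) :
    ∃ (n : Fin d → ℕ) (σ : Equiv.Perm (Fin d)) (b : ℝ), (∀ i, n i ≤ N) ∧ Antitone (n ∘ σ) ∧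
      c * N ≤ b ∧ (∀ i, b ≤ Φ.birkhoff ω i (n i)) ∧ (∀ i, Φ.birkhoff ω i (n i) ≤ b + C) ∧
      ∃ l, Φ.birkhoff ω l N = b := by
  obtain ⟨l, hl⟩ := Finite.exists_min fun i => Φ.birkhoff ω i N
  have hex : ∀ i, ∃ m, Φ.birkhoff ω l N ≤ Φ.birkhoff ω i m := fun i => ⟨N, hl i⟩
  have hcN := Φ.le_birkhoff (fun i a => (h i a).1) ω l N
  let n : Fin d → ℕ := fun i => Nat.find (hex i)
  refine ⟨n, Tuple.sort (OrderDual.toDual ∘ n), Φ.birkhoff ω l N, fun i => Nat.find_le (hl i),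
    fun i j hij => Tuple.monotone_sort (OrderDual.toDual ∘ n) hij, hcN,
    fun i => Nat.find_spec (hex i), fun i => ?_, l, rfl⟩
  have hC : 0 < C := hc.trans_le ((h l (ω 0)).1.trans (h l (ω 0)).2)
  rcases hn : n i with _ | m
  · have : 0 ≤ c * N := by positivity
    simp only [birkhoff, Finset.range_zero, Finset.sum_empty] at *
    linarith
  · have hm : Φ.birkhoff ω i m < Φ.birkhoff ω l N :=
      not_le.1 (Nat.find_min (hex i) (show m < n i by omega))
    rw [birkhoff, Finset.sum_range_succ, ← birkhoff]
    linarith [(h i (ω m)).2]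

/-- the ratio of the entropy and the Lyapunov exponent of coordinate `i` at time `m` -/
noncomputable def coordDim (Φ : DiagIFS d A) (ω : ℕ → Φ.Symb) (i : Fin d) (m : ℕ) : ℝ :=
  Φ.entropy {i} (Φ.freq ω m) / Φ.chi i (Φ.freq ω m)

theorem chi_freq_pos (Φ : DiagIFS d A) {c : ℝ} (hc : 0 < c) (h : ∀ i a, c ≤ Φ.rate i a)
    (ω : ℕ → Φ.Symb) (i : Fin d) {m : ℕ} (hm : 0 < m) : 0 < Φ.chi i (Φ.freq ω m) := by
  have h1 := Φ.le_birkhoff h ω i m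
  rw [birkhoff_eq, mul_comm] at h1
  exact hc.trans_le (le_of_mul_le_mul_left (by linarith) (Nat.cast_pos.2 hm))

theorem coordDim_nonneg (Φ : DiagIFS d A) {c : ℝ} (hc : 0 < c) (h : ∀ i a, c ≤ Φ.rate i a)
    (ω : ℕ → Φ.Symb) (i : Fin d) {m : ℕ} (hm : 0 < m) : 0 ≤ Φ.coordDim ω i m :=
  div_nonneg (Φ.entropy_nonneg (Φ.freq_isProbVec ω hm) _) (Φ.chi_freq_pos hc h ω i hm).le

theorem coordDim_le (Φ : DiagIFS d A) {c S : ℝ} (hc : 0 < c) (h : ∀ i a, c ≤ Φ.rate i a)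
    (hS : Φ.TwoScaleBound S) (ω : ℕ → Φ.Symb) (i : Fin d) {m : ℕ} (hm : 0 < m) :
    Φ.coordDim ω i m ≤ S := by
  have hχ := Φ.chi_freq_pos hc h ω i hm
  have hle : ∀ j ∈ ({i} : Finset (Fin d)), (Φ.chi i (Φ.freq ω m))⁻¹ * Φ.chi j (Φ.freq ω m) ≤ 1 := by
    intro j hj
    rw [Finset.mem_singleton.1 hj, inv_mul_cancel₀ hχ.ne']
  have := hS _ (Φ.freq_isProbVec ω hm) {i} {i} _ _ (inv_pos.2 hχ) le_rfl hle hle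
  rw [coordDim, div_eq_inv_mul]
  linarith

theorem mul_chi_le_of_mem_pre (Φ : DiagIFS d A) {c B : ℝ} (hc : 0 < c)
    (h : ∀ i a, c ≤ Φ.rate i a) {ω : ℕ → Φ.Symb} {n : Fin d → ℕ} {σ : Equiv.Perm (Fin d)}
    (hσ : Antitone (n ∘ σ)) (hB : ∀ i, Φ.birkhoff ω i (n i) ≤ B) {i j : Fin d} (hi : i ∈ pre σ (j + 1)) :
    n (σ j) * Φ.chi i (Φ.freq ω (n (σ j))) ≤ B := by
  rw [← birkhoff_eq]
  refine le_trans ((Φ.birkhoff_mono hc h ω i).monotone ?_) (hB i)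
  have hi : (σ.symm i : ℕ) < j + 1 := by simpa [pre] using hi
  have := hσ (show σ.symm i ≤ j from Nat.lt_succ_iff.1 hi)
  simpa using this

theorem cost_le (Φ : DiagIFS d A) {c S B : ℝ} (hc : 0 < c) (h : ∀ i a, c ≤ Φ.rate i a)
    (hS : Φ.TwoScaleBound S) {ω : ℕ → Φ.Symb} {n : Fin d → ℕ} {σ : Equiv.Perm (Fin d)}
    (hσ : Antitone (n ∘ σ)) (hn : ∀ i, 0 < n i) (hB : ∀ i, Φ.birkhoff ω i (n i) ≤ B)
    (hB0 : 0 < B) (j : Fin d) :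
    Φ.cost n (fun i => Φ.freq ω (n i)) σ j ≤ B * S := by
  have hn' : (0 : ℝ) < n (σ j) := Nat.cast_pos.2 (hn _)
  have hp := Φ.freq_isProbVec ω (hn (σ j))
  have hle : ∀ i ∈ pre σ (j + 1), n (σ j) / B * Φ.chi i (Φ.freq ω (n (σ j))) ≤ 1 := by
    intro i hi
    rw [div_mul_eq_mul_div, div_le_one hB0]
    exact Φ.mul_chi_le_of_mem_pre hc h hσ hB hi
  have key := hS _ hp _ _ _ _ (div_pos hn' hB0) le_rfl hle hle
  rw [sub_self, zero_mul, add_zero, div_mul_eq_mul_div, div_le_iff₀ hB0] at key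
  have := mul_nonneg hn'.le (Φ.entropy_nonneg hp (pre σ j))
  rw [cost]
  linarith

theorem sum_cost_le {k : ℕ} {A : Fin (k + 2) → Type} [∀ i, Fintype (A i)] (Φ : DiagIFS (k + 2) A)
    {c S B : ℝ} (hc : 0 < c) (h : ∀ i a, c ≤ Φ.rate i a)
    (hS : Φ.TwoScaleBound S) {ω : ℕ → Φ.Symb} {n : Fin (k + 2) → ℕ}
    {σ : Equiv.Perm (Fin (k + 2))} (hσ : Antitone (n ∘ σ)) (hn : ∀ i, 0 < n i)
    (hB : ∀ i, Φ.birkhoff ω i (n i) ≤ B) (hB0 : 0 < B) :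
    ∑ j, Φ.cost n (fun i => Φ.freq ω (n i)) σ j ≤ B * ((k + 1 : ℕ) * S +
      (Φ.coordDim ω (σ 0) (n (σ 0)) - Φ.coordDim ω (σ 0) (n (σ 1)))) := by
  have hpre0 : pre σ 0 = ∅ := by simp [pre]
  have hpre1 : pre σ 1 = {σ 0} := by simpa [hpre0] using pre_succ σ 0
  have h0 : Φ.cost n (fun i => Φ.freq ω (n i)) σ 0 ≤ B * Φ.coordDim ω (σ 0) (n (σ 0)) := by
    have hχ := Φ.chi_freq_pos hc h ω (σ 0) (hn (σ 0))
    have hf := Φ.coordDim_nonneg hc h ω (σ 0) (hn (σ 0))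
    refine le_trans (le_of_eq ?_) (mul_le_mul_of_nonneg_right (hB (σ 0)) hf)
    rw [cost, Fin.val_zero, zero_add, hpre0, hpre1, Φ.entropy_empty (Φ.freq_isProbVec ω (hn _)),
      birkhoff_eq, coordDim]
    field_simp
    ring
  have h1 : Φ.cost n (fun i => Φ.freq ω (n i)) σ 1 ≤
      B * (S - Φ.coordDim ω (σ 0) (n (σ 1))) := by
    have hn' : (0 : ℝ) < n (σ 1) := Nat.cast_pos.2 (hn _)
    have hχ := Φ.chi_freq_pos hc h ω (σ 0) (hn (σ 1))
    have hle : ∀ i ∈ pre σ ((1 : Fin (k + 2)) + 1 : ℕ),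
        n (σ 1) * Φ.chi i (Φ.freq ω (n (σ 1))) ≤ B := fun i hi =>
      Φ.mul_chi_le_of_mem_pre hc h hσ hB hi
    have key := hS _ (Φ.freq_isProbVec ω (hn (σ 1))) {σ 0} (pre σ ((1 : Fin (k + 2)) + 1 : ℕ))
      (n (σ 1) / B) (Φ.chi (σ 0) (Φ.freq ω (n (σ 1))))⁻¹ (div_pos hn' hB0) ?_ ?_ ?_
    · have e : Φ.coordDim ω (σ 0) (n (σ 1)) = (Φ.chi (σ 0) (Φ.freq ω (n (σ 1))))⁻¹ *
          Φ.entropy {σ 0} (Φ.freq ω (n (σ 1))) := by rw [coordDim, div_eq_inv_mul]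
      have hv : ((1 : Fin (k + 2)) : ℕ) = 1 := rfl
      rw [cost, e]
      nth_rw 2 [hv]
      rw [hpre1]
      have := mul_le_mul_of_nonneg_left key hB0.le
      rw [mul_add, ← mul_assoc, mul_div_cancel₀ _ hB0.ne', sub_mul, mul_sub B, ← mul_assoc B (_ / B),
        mul_div_cancel₀ _ hB0.ne'] at this
      linarith
    · rw [div_le_iff₀ hB0, ← div_eq_inv_mul, le_div_iff₀ hχ]
      refine hle _ ?_
      simp [pre]
    · intro i hi
      rw [Finset.mem_singleton.1 hi, inv_mul_cancel₀ hχ.ne']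
    · intro i hi
      rw [div_mul_eq_mul_div, div_le_one hB0]
      exact hle i hi
  rw [Fin.sum_univ_succ, Fin.sum_univ_succ, Fin.succ_zero_eq_one]
  have h2 := Finset.sum_le_card_nsmul Finset.univ
    (fun j : Fin k => Φ.cost n (fun i => Φ.freq ω (n i)) σ j.succ.succ) (B * S)
    fun j _ => Φ.cost_le hc h hS hσ hn hB hB0 _
  rw [Finset.card_univ, Fintype.card_fin, nsmul_eq_mul] at h2
  push_cast
  linarith

end DiagIFS

/-- A function on `ℕ` that is bounded and nonnegative for positive arguments cannot increase
by `ε` between `m N` and `N` for all large `N`. -/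
theorem frequently_le_add {f : ℕ → ℝ} {m : ℕ → ℕ} {S ε : ℝ} (hf0 : ∀ N, 0 < N → 0 ≤ f N)
    (hfS : ∀ N, 0 < N → f N ≤ S) (hm : Tendsto m atTop atTop) (hε : 0 < ε) :
    ∃ᶠ N in atTop, f N ≤ f (m N) + ε := by
  intro h
  have key : ∀ k : ℕ, ∀ᶠ N in atTop, k * ε ≤ f N := by
    intro k
    induction k with
    | zero => filter_upwards [eventually_gt_atTop 0] with N hN using by simpa using hf0 N hN
    | succ k ih =>
      filter_upwards [h, hm.eventually ih] with N h1 h2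
      push_cast
      linarith [not_le.1 h1]
  obtain ⟨k, hk⟩ := exists_nat_gt (S / ε)
  obtain ⟨N, h1, h2⟩ := ((key k).and (eventually_gt_atTop 0)).exists
  rw [div_lt_iff₀ hε] at hk
  linarith [hfS N h2]

namespace DiagIFS

/-- Infinitely often, the dimension of the last coordinate to be stopped does not increase much
between the last two stopping times. -/
theorem frequently_coordDim_le {k : ℕ} {A : Fin (k + 2) → Type} [∀ i, Fintype (A i)]
    (Φ : DiagIFS (k + 2) A) {c C S ε : ℝ} (hc : 0 < c)
    (h : ∀ i a, c ≤ Φ.rate i a ∧ Φ.rate i a ≤ C) (hS : Φ.TwoScaleBound S) (hε : 0 < ε)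
    {ω : ℕ → Φ.Symb} {n : ℕ → Fin (k + 2) → ℕ} {σ : ℕ → Equiv.Perm (Fin (k + 2))} {b : ℕ → ℝ}
    (hn : ∀ N i, n N i ≤ N) (hσ : ∀ N, Antitone (n N ∘ σ N)) (hcb : ∀ N, c * N ≤ b N)
    (hb : ∀ N i, b N ≤ Φ.birkhoff ω i (n N i)) (hl : ∀ N, ∃ l, Φ.birkhoff ω l N = b N) :
    ∃ᶠ N in atTop, Φ.coordDim ω (σ N 0) (n N (σ N 0)) ≤
      Φ.coordDim ω (σ N 0) (n N (σ N 1)) + ε := by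
  have mono := Φ.birkhoff_mono hc (fun i a => (h i a).1) ω
  have hlead : ∀ N l, Φ.birkhoff ω l N = b N → n N l = N := fun N l hl =>
    (hn N l).antisymm ((mono l).le_iff_le.1 (hl.trans_le (hb N l)))
  have hmax : ∀ N, n N (σ N 0) = N := by
    intro N
    obtain ⟨l, hl⟩ := hl N
    refine (hn N _).antisymm ?_
    have := hσ N (Fin.zero_le ((σ N).symm l))
    simpa [hlead N l hl] using this
  intro hlt
  obtain ⟨N₀, hN₀⟩ := eventually_atTop.1 hlt
  have hsnd : ∀ N ≥ N₀, ∀ j ≠ σ N 0, n N j < N := by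
    intro N hN j hj
    have h1 : n N (σ N 1) ≠ N := fun e => hN₀ N hN (by dsimp only; rw [e, hmax]; linarith)
    have h2 : (1 : Fin (k + 2)) ≤ (σ N).symm j := by
      refine Fin.one_le_of_ne_zero fun e => hj ?_
      rw [← e, Equiv.apply_symm_apply]
    have h3 := hσ N h2
    simp only [Function.comp_apply, Equiv.apply_symm_apply] at h3
    exact h3.trans_lt (lt_of_le_of_ne (hn N _) h1)
  have hfst : ∀ N ≥ N₀, Φ.birkhoff ω (σ N 0) N = b N := by
    intro N hN
    obtain ⟨l, hl⟩ := hl N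
    by_cases e : l = σ N 0
    · rw [← e, hl]
    · exact absurd (hlead N l hl) (hsnd N hN l e).ne
  have hconst : ∀ N ≥ N₀, σ N 0 = σ N₀ 0 := by
    intro N hN
    induction N, hN using Nat.le_induction with
    | base => rfl
    | succ N hN ih =>
      rw [← ih]
      by_contra hne
      have h1 := hb (N + 1) (σ N 0)
      have h2 := (mono (σ N 0)).monotone
        (Nat.lt_succ_iff.1 (hsnd (N + 1) (hN.trans N.le_succ) _ (Ne.symm hne)))
      have h3 := mono (σ (N + 1) 0) N.lt_succ_self
      have h4 := (hb N (σ (N + 1) 0)).trans ((mono _).monotone (hn N _))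
      have h5 := hfst N hN
      have h6 := hfst (N + 1) (hN.trans N.le_succ)
      simp only [Nat.succ_eq_add_one] at *
      linarith
  have hC : 0 < C := hc.trans_le ((h 0 (ω 0)).1.trans (h 0 (ω 0)).2)
  have htend : Tendsto (fun N => n N (σ N 1)) atTop atTop := by
    refine tendsto_natCast_atTop_iff.1 (tendsto_atTop_mono (f := fun N : ℕ => c / C * (N : ℝ))
      (fun N => ?_) (tendsto_natCast_atTop_atTop.const_mul_atTop (div_pos hc hC)))
    rw [div_mul_eq_mul_div, div_le_iff₀ hC]
    linarith [hcb N, hb N (σ N 1), Φ.birkhoff_le (fun i a => (h i a).2) ω (σ N 1) (n N (σ N 1))]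
  refine frequently_le_add (f := Φ.coordDim ω (σ N₀ 0))
    (fun N hN => Φ.coordDim_nonneg hc (fun i a => (h i a).1) ω _ hN)
    (fun N hN => Φ.coordDim_le hc (fun i a => (h i a).1) hS ω _ hN) htend hε ?_
  filter_upwards [eventually_ge_atTop N₀] with N hN
  have := hN₀ N hN
  dsimp only at this
  rwa [hmax, hconst N hN] at this

theorem dimH_limitSet_le_of_sum_cost_le [NeZero d] (Φ : DiagIFS d A) (hV : Φ.Valid) {c C S : ℝ}
    (hc : 0 < c) (h : ∀ i a, c ≤ Φ.rate i a ∧ Φ.rate i a ≤ C) (hS : 0 ≤ S)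
    (H : ∀ ε > 0, ∀ (ω : ℕ → Φ.Symb) (n : ℕ → Fin d → ℕ) (σ : ℕ → Equiv.Perm (Fin d)) (b : ℕ → ℝ),
      (∀ N i, n N i ≤ N) → (∀ N, Antitone (n N ∘ σ N)) → (∀ N, c * N ≤ b N) →
      (∀ N i, b N ≤ Φ.birkhoff ω i (n N i)) → (∀ N i, Φ.birkhoff ω i (n N i) ≤ b N + C) →
      (∀ N, ∃ l, Φ.birkhoff ω l N = b N) → (∀ N > 0, ∀ i, 0 < n N i) →
      ∃ᶠ N : ℕ in atTop, ∑ j, Φ.cost (n N) (fun i => Φ.freq ω (n N i)) (σ N) j ≤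
        (b N + C) * (S + ε)) :
    dimH Φ.limitSet ≤ ENNReal.ofReal S := by
  refine ENNReal.le_of_forall_pos_le_add fun δ hδ _ => ?_
  have hδ' : (0 : ℝ) < δ := hδ
  have hs : ENNReal.ofReal S + δ = ((S.toNNReal + δ : ℝ≥0) : ℝ≥0∞) := by
    rw [ENNReal.coe_add]; rfl
  rw [hs]
  refine Φ.dimH_limitSet_le hV hc _ fun ω => ?_
  choose n σ b hn hσ hcb hb hbC hl using Φ.exists_stopping hc h ω
  have hpos : ∀ N > 0, ∀ i, 0 < n N i := by
    intro N hN i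
    refine Nat.pos_of_ne_zero fun e => ?_
    have h1 := (hcb N).trans (hb N i)
    have h2 : 0 < c * N := mul_pos hc (Nat.cast_pos.2 hN)
    rw [e] at h1
    simp only [birkhoff, Finset.range_zero, Finset.sum_empty] at h1
    linarith
  have hfr := H (δ / 2) (by positivity) ω n σ b hn hσ hcb hb hbC hl hpos
  obtain ⟨N₁, hN₁⟩ := exists_nat_gt (C * (S + δ / 2) / (δ / 2) / c)
  refine (hfr.and_eventually (eventually_ge_atTop N₁)).mono fun N ⟨h1, h2⟩ =>
    ⟨n N, σ N, b N, hn N, hσ N, hcb N, hb N, h1.trans ?_⟩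
  have h3 : (N₁ : ℝ) ≤ N := Nat.cast_le.2 h2
  have h4 : C * (S + δ / 2) / (δ / 2) < b N := by
    refine lt_of_lt_of_le ?_ (hcb N)
    rw [div_lt_iff₀ hc] at hN₁
    nlinarith
  rw [div_lt_iff₀ (by positivity)] at h4
  rw [NNReal.coe_add, Real.coe_toNNReal S hS]
  linarith

end DiagIFS

theorem DiagIFS.dimH_limitSet_le_dynDim_mul (Φ : DiagIFS d A) (hV : Φ.Valid)
    (hGood : ∀ p : Φ.Symb → ℝ, IsProbVec p → Φ.GoodVec p) :
    dimH Φ.limitSet ≤ ((max 1 (d - 1) : ℕ) : ℝ≥0∞) * Φ.dynDim := by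
  obtain ⟨c, hc, C, hC, h⟩ := Φ.exists_rate_bounds hV
  have hS := Φ.twoScaleBound_dynDim hV hGood
  have hcast (M : ℕ) : ENNReal.ofReal (M * Φ.dynDim.toReal) = (M : ℝ≥0∞) * Φ.dynDim := by
    rw [ENNReal.ofReal_mul (Nat.cast_nonneg _), ENNReal.ofReal_natCast,
      ENNReal.ofReal_toReal (Φ.dynDim_ne_top hV)]
  have hB0 {b : ℕ → ℝ} (hcb : ∀ N : ℕ, c * N ≤ b N) (N : ℕ) : 0 < b N + C := by
    have : 0 ≤ c * (N : ℝ) := by positivity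
    linarith [hcb N]
  rw [← hcast]
  obtain rfl | rfl | ⟨k, rfl⟩ : d = 0 ∨ d = 1 ∨ ∃ k, d = k + 2 := by
    rcases d with _ | _ | k <;> simp
  · exact (Set.subsingleton_of_subsingleton.dimH_zero).trans_le bot_le
  · refine Φ.dimH_limitSet_le_of_sum_cost_le hV hc h (by positivity) ?_
    intro ε hε ω n σ b _ hσ hcb _ hbC _ hpos
    refine (Filter.eventually_gt_atTop 0).frequently.mono fun N hN => ?_
    have := Φ.cost_le hc (fun i a => (h i a).1) hS (hσ N) (hpos N hN) (hbC N) (hB0 hcb N) 0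
    rw [Fin.sum_univ_one]
    have := mul_pos (hB0 hcb N) hε
    norm_num
    linarith
  · refine Φ.dimH_limitSet_le_of_sum_cost_le hV hc h (by positivity) ?_
    intro ε hε ω n σ b hn hσ hcb hb hbC hl hpos
    refine ((Φ.frequently_coordDim_le hc h hS hε hn hσ hcb hb hl).and_eventually
      (eventually_gt_atTop 0)).mono fun N ⟨hN, hN0⟩ => ?_
    refine (Φ.sum_cost_le hc (fun i a => (h i a).1) hS (hσ N) (hpos N hN0) (hbC N)
      (hB0 hcb N)).trans (mul_le_mul_of_nonneg_left ?_ (hB0 hcb N).le)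
    rw [show max 1 (k + 2 - 1) = k + 1 by omega]
    linarith

/-- For every good sponge in `[0,1]^d`: `HD(Λ_Φ) ≤ max(1, d-1) · DynD(Φ)`;
in particular if `d ≤ 2` then `HD(Λ_Φ) = DynD(Φ)`. -/
theorem dimH_le_dynDim_mul {d : ℕ} {A : Fin d → Type} [∀ i, Fintype (A i)]
    (Φ : DiagIFS d A) (hV : Φ.Valid)
    (hGood : ∀ p : Φ.Symb → ℝ, IsProbVec p → Φ.GoodVec p) :
    dimH Φ.limitSet ≤ ((max 1 (d - 1) : ℕ) : ℝ≥0∞) * Φ.dynDim ∧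
    (d ≤ 2 → dimH Φ.limitSet = Φ.dynDim) := by
  have key := Φ.dimH_limitSet_le_dynDim_mul hV hGood
  refine ⟨key, fun hd => le_antisymm ?_ (Φ.dynDim_le_dimH hV)⟩
  rwa [max_eq_left (by omega), Nat.cast_one, one_mul] at key

end SelfAffineSponge
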